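/- The abstract algebra 𝒮 over F = ℂ(q) with generators s_ij (1 ≤ i,j ≤ 2n) and s_{ii′}^{−1} (i = 1,3,…,2n−1) and defining relations s_ij = 0 for i < j with j ≠ i′; s_{i′i′} s_ii − q² s_{i′i} s_{ii′} = q³ and s_{ii′} s_{ii′}^{−1} = s_{ii′}^{−1} s_{ii′} = 1 for odd i; and R S₁ Rᵗ S₂ = S₂ Rᵗ S₁ R for S = Σ s_ij⊗E_ij, is isomorphic to the twisted quantized enveloping algebra U^tw_q(sp_2n), via the map sending s_ij to the (i,j) entry of T G T̄ᵗ and s_{ii′}^{−1} to the inverse of the corresponding entry. -/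

import Mathlib

noncomputable section

open scoped TensorProduct

abbrev FF : Type := RatFunc ℂ

def qq : FF := RatFunc.X

/-! Constant R-matrices acting in `ℂ^N ⊗ ℂ^N`, written as matrices indexed by pairs. -/

def Rc (F : Type) [Field F] (q : F) (N : ℕ) :
    Matrix (Fin N × Fin N) (Fin N × Fin N) F := Matrix.of fun p r =>
  (if p = r then (if p.1 = p.2 then q else 1) else 0)
  + (if p.1 = r.2 ∧ p.2 = r.1 ∧ p.1 < p.2 then q - q⁻¹ else 0)

/-- `R` transposed in the first tensor factor. -/
def Rct (F : Type) [Field F] (q : F) (N : ℕ) :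
    Matrix (Fin N × Fin N) (Fin N × Fin N) F :=
  Matrix.of fun p r => Rc F q N (r.1, p.2) (p.1, r.2)

def Rtil (F : Type) [Field F] (q : F) (N : ℕ) :
    Matrix (Fin N × Fin N) (Fin N × Fin N) F := Matrix.of fun p r =>
  (if p = r then (if p.1 = p.2 then q⁻¹ else 1) else 0)
  + (if p.1 = r.2 ∧ p.2 = r.1 ∧ p.2 < p.1 then q⁻¹ - q else 0)

def Rtilt (F : Type) [Field F] (q : F) (N : ℕ) :
    Matrix (Fin N × Fin N) (Fin N × Fin N) F :=
  Matrix.of fun p r => Rtil F q N (r.1, p.2) (p.1, r.2)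

/-- `S ↦ S ⊗ 1` (action in the first copy of `End ℂ^N`). -/
def amp1 {A : Type} [Ring A] {N : ℕ} (M : Matrix (Fin N) (Fin N) A) :
    Matrix (Fin N × Fin N) (Fin N × Fin N) A :=
  Matrix.of fun p r => if p.2 = r.2 then M p.1 r.1 else 0

/-- `S ↦ 1 ⊗ S` (action in the second copy of `End ℂ^N`). -/
def amp2 {A : Type} [Ring A] {N : ℕ} (M : Matrix (Fin N) (Fin N) A) :
    Matrix (Fin N × Fin N) (Fin N × Fin N) A :=
  Matrix.of fun p r => if p.1 = r.1 then M p.2 r.2 else 0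

/-- A scalar matrix viewed as a matrix over an `F`-algebra `A`. -/
def liftF (F : Type) [Field F] {A : Type} [Ring A] [Algebra F A] {m : Type}
    (M : Matrix m m F) : Matrix m m A := M.map (algebraMap F A)

/-- Left hand side `R S₁ Rᵗ S₂` of the reflection equation. -/
def reflLHS (F : Type) [Field F] (q : F) {N : ℕ} {A : Type} [Ring A] [Algebra F A]
    (S : Matrix (Fin N) (Fin N) A) : Matrix (Fin N × Fin N) (Fin N × Fin N) A :=
  liftF F (Rc F q N) * amp1 S * liftF F (Rct F q N) * amp2 S

/-- Right hand side `S₂ Rᵗ S₁ R` of the reflection equation. -/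
def reflRHS (F : Type) [Field F] (q : F) {N : ℕ} {A : Type} [Ring A] [Algebra F A]
    (S : Matrix (Fin N) (Fin N) A) : Matrix (Fin N × Fin N) (Fin N × Fin N) A :=
  amp2 S * liftF F (Rct F q N) * amp1 S * liftF F (Rc F q N)

/-- The list of index pairs `(i,j)` in lexicographic order. -/
def lexPairs (N : ℕ) : List (Fin N × Fin N) :=
  (List.finRange N).flatMap fun i => (List.finRange N).map fun j => (i, j)

/-! The generic matrix of generators. -/

def Sfree (F : Type) [Field F] (N : ℕ) :
    Matrix (Fin N) (Fin N) (FreeAlgebra F (Fin N × Fin N)) :=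
  Matrix.of fun i j => FreeAlgebra.ι F (i, j)

/-- Defining relations: only the reflection equation. -/
inductive Rel0 (F : Type) [Field F] (q : F) (N : ℕ) :
    FreeAlgebra F (Fin N × Fin N) → FreeAlgebra F (Fin N × Fin N) → Prop
  | refl (p r : Fin N × Fin N) :
      Rel0 F q N (reflLHS F q (Sfree F N) p r) (reflRHS F q (Sfree F N) p r)

/-- The algebra with generators `s_ij` and the reflection equation as defining relations. -/
abbrev Alg0 (F : Type) [Field F] (q : F) (N : ℕ) := RingQuot (Rel0 F q N)

def s0 (F : Type) [Field F] (q : F) (N : ℕ) (i j : Fin N) : Alg0 F q N :=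
  RingQuot.mkAlgHom F (Rel0 F q N) (FreeAlgebra.ι F (i, j))

/-- Defining relations of the presented algebra `𝒮` of the orthogonal case. -/
inductive OSRel (F : Type) [Field F] (q : F) (N : ℕ) :
    FreeAlgebra F (Fin N × Fin N) → FreeAlgebra F (Fin N × Fin N) → Prop
  | tri (i j : Fin N) (h : i < j) : OSRel F q N (FreeAlgebra.ι F (i, j)) 0
  | diag (i : Fin N) : OSRel F q N (FreeAlgebra.ι F (i, i)) 1
  | refl (p r : Fin N × Fin N) :
      OSRel F q N (reflLHS F q (Sfree F N) p r) (reflRHS F q (Sfree F N) p r)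

abbrev AlgOS (F : Type) [Field F] (q : F) (N : ℕ) := RingQuot (OSRel F q N)

def sOS (F : Type) [Field F] (q : F) (N : ℕ) (i j : Fin N) : AlgOS F q N :=
  RingQuot.mkAlgHom F (OSRel F q N) (FreeAlgebra.ι F (i, j))

/-! The quantized enveloping algebra `U_q(gl_N)` by its RTT presentation. -/

abbrev GlGen (N : ℕ) := (Fin N × Fin N) ⊕ (Fin N × Fin N)

def Tfree (F : Type) [Field F] (N : ℕ) :
    Matrix (Fin N) (Fin N) (FreeAlgebra F (GlGen N)) :=
  Matrix.of fun i j => FreeAlgebra.ι F (Sum.inl (i, j))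

def Tbfree (F : Type) [Field F] (N : ℕ) :
    Matrix (Fin N) (Fin N) (FreeAlgebra F (GlGen N)) :=
  Matrix.of fun i j => FreeAlgebra.ι F (Sum.inr (i, j))

/-- `R X₁ Y₂` -/
def rttLHS (F : Type) [Field F] (q : F) {N : ℕ} {A : Type} [Ring A] [Algebra F A]
    (X Y : Matrix (Fin N) (Fin N) A) : Matrix (Fin N × Fin N) (Fin N × Fin N) A :=
  liftF F (Rc F q N) * amp1 X * amp2 Y

/-- `Y₂ X₁ R` -/
def rttRHS (F : Type) [Field F] (q : F) {N : ℕ} {A : Type} [Ring A] [Algebra F A]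
    (X Y : Matrix (Fin N) (Fin N) A) : Matrix (Fin N × Fin N) (Fin N × Fin N) A :=
  amp2 Y * amp1 X * liftF F (Rc F q N)

inductive GlRel (F : Type) [Field F] (q : F) (N : ℕ) :
    FreeAlgebra F (GlGen N) → FreeAlgebra F (GlGen N) → Prop
  | t_zero (i j : Fin N) (h : i < j) : GlRel F q N (Tfree F N i j) 0
  | tb_zero (i j : Fin N) (h : j < i) : GlRel F q N (Tbfree F N i j) 0
  | t_tb (i : Fin N) : GlRel F q N (Tfree F N i i * Tbfree F N i i) 1
  | tb_t (i : Fin N) : GlRel F q N (Tbfree F N i i * Tfree F N i i) 1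
  | rtt (p r : Fin N × Fin N) :
      GlRel F q N (rttLHS F q (Tfree F N) (Tfree F N) p r)
        (rttRHS F q (Tfree F N) (Tfree F N) p r)
  | rtbtb (p r : Fin N × Fin N) :
      GlRel F q N (rttLHS F q (Tbfree F N) (Tbfree F N) p r)
        (rttRHS F q (Tbfree F N) (Tbfree F N) p r)
  | rtbt (p r : Fin N × Fin N) :
      GlRel F q N (rttLHS F q (Tbfree F N) (Tfree F N) p r)
        (rttRHS F q (Tbfree F N) (Tfree F N) p r)

/-- The quantized enveloping algebra `U_q(gl_N)`. -/
abbrev UqGl (F : Type) [Field F] (q : F) (N : ℕ) := RingQuot (GlRel F q N)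

def tE (F : Type) [Field F] (q : F) (N : ℕ) (i j : Fin N) : UqGl F q N :=
  RingQuot.mkAlgHom F (GlRel F q N) (FreeAlgebra.ι F (Sum.inl (i, j)))

def tbE (F : Type) [Field F] (q : F) (N : ℕ) (i j : Fin N) : UqGl F q N :=
  RingQuot.mkAlgHom F (GlRel F q N) (FreeAlgebra.ι F (Sum.inr (i, j)))

/-- The entries `s_ij = Σ_a t_ia t̄_ja` of `S = T T̄ᵗ`. -/
def sE (F : Type) [Field F] (q : F) (N : ℕ) (i j : Fin N) : UqGl F q N :=
  ∑ a : Fin N, tE F q N i a * tbE F q N j a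

/-- The twisted quantized enveloping algebra `U^tw_q(o_N)` as a subalgebra of `U_q(gl_N)`. -/
def UtwO (F : Type) [Field F] (q : F) (N : ℕ) : Subalgebra F (UqGl F q N) :=
  Algebra.adjoin F {x | ∃ i j, x = sE F q N i j}

/-! Symplectic (finite) case. -/

/-- `2k` as an element of `Fin (2n)` (the 0-based version of the odd index `2k-1`). -/
def fe (n : ℕ) (k : Fin n) : Fin (2 * n) := ⟨2 * k.val, by have := k.isLt; omega⟩

/-- `2k+1` as an element of `Fin (2n)` (the 0-based version of the even index `2k`). -/
def fo (n : ℕ) (k : Fin n) : Fin (2 * n) := ⟨2 * k.val + 1, by have := k.isLt; omega⟩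

/-- The entries `s_ij` of `S = T G T̄ᵗ` in `U_q(gl_2n)`. -/
def sSp (F : Type) [Field F] (q : F) (n : ℕ) (i j : Fin (2 * n)) : UqGl F q (2 * n) :=
  algebraMap F _ q * ∑ a : Fin n, tE F q (2 * n) i (fe n a) * tbE F q (2 * n) j (fo n a)
    - ∑ a : Fin n, tE F q (2 * n) i (fo n a) * tbE F q (2 * n) j (fe n a)

abbrev SpGen (n : ℕ) := (Fin (2 * n) × Fin (2 * n)) ⊕ Fin n

def SpFreeS (F : Type) [Field F] (n : ℕ) :
    Matrix (Fin (2 * n)) (Fin (2 * n)) (FreeAlgebra F (SpGen n)) :=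
  Matrix.of fun i j => FreeAlgebra.ι F (Sum.inl (i, j))

/-- Defining relations of the presented algebra `𝒮` of the symplectic case. -/
inductive SpRel (F : Type) [Field F] (q : F) (n : ℕ) :
    FreeAlgebra F (SpGen n) → FreeAlgebra F (SpGen n) → Prop
  | tri (i j : Fin (2 * n)) (h : i < j) (h' : ¬(i.val % 2 = 0 ∧ j.val = i.val + 1)) :
      SpRel F q n (FreeAlgebra.ι F (Sum.inl (i, j))) 0
  | quad (k : Fin n) :
      SpRel F q n
        (FreeAlgebra.ι F (Sum.inl (fo n k, fo n k)) * FreeAlgebra.ι F (Sum.inl (fe n k, fe n k)))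
        (algebraMap F _ (q ^ 2) *
            (FreeAlgebra.ι F (Sum.inl (fo n k, fe n k)) *
              FreeAlgebra.ι F (Sum.inl (fe n k, fo n k)))
          + algebraMap F _ (q ^ 3))
  | invR (k : Fin n) :
      SpRel F q n
        (FreeAlgebra.ι F (Sum.inl (fe n k, fo n k)) * FreeAlgebra.ι F (Sum.inr k)) 1
  | invL (k : Fin n) :
      SpRel F q n
        (FreeAlgebra.ι F (Sum.inr k) * FreeAlgebra.ι F (Sum.inl (fe n k, fo n k))) 1
  | refl (p r : Fin (2 * n) × Fin (2 * n)) :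
      SpRel F q n (reflLHS F q (SpFreeS F n) p r) (reflRHS F q (SpFreeS F n) p r)

abbrev AlgSp (F : Type) [Field F] (q : F) (n : ℕ) := RingQuot (SpRel F q n)

def sSpP (F : Type) [Field F] (q : F) (n : ℕ) (i j : Fin (2 * n)) : AlgSp F q n :=
  RingQuot.mkAlgHom F (SpRel F q n) (FreeAlgebra.ι F (Sum.inl (i, j)))

def sInvP (F : Type) [Field F] (q : F) (n : ℕ) (k : Fin n) : AlgSp F q n :=
  RingQuot.mkAlgHom F (SpRel F q n) (FreeAlgebra.ι F (Sum.inr k))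

/-- row `i = 2k` of the symplectic ordered monomial: positions `(i,0),…,(i,2k)`. -/
def rowA (n : ℕ) (k : Fin n) : List (Fin (2 * n) × Fin (2 * n)) :=
  ((List.finRange (2 * n)).filter fun j => j.val ≤ 2 * k.val).map fun j => (fe n k, j)

/-- row `i' = 2k+1` of the symplectic ordered monomial: positions `(i',0),…,(i',2k-1)`. -/
def rowB (n : ℕ) (k : Fin n) : List (Fin (2 * n) × Fin (2 * n)) :=
  ((List.finRange (2 * n)).filter fun j => j.val + 2 ≤ 2 * k.val + 1).map fun j => (fo n k, j)

/-- The ordered monomials of the symplectic case, with an arbitrary integer exponent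
on each `s_{i i'}` and nonnegative exponents elsewhere. -/
def monomSp {A : Type} [Ring A] (n : ℕ) (s : Fin (2 * n) × Fin (2 * n) → A) (sI : Fin n → A)
    (kN : Fin (2 * n) × Fin (2 * n) → ℕ) (kZ : Fin n → ℤ) : A :=
  ((List.finRange n).map fun k =>
    ((rowA n k).map fun p => s p ^ kN p).prod *
      (if 0 ≤ kZ k then s (fe n k, fo n k) ^ (kZ k).toNat else sI k ^ (-(kZ k)).toNat) *
      s (fo n k, fo n k) ^ kN (fo n k, fo n k) *
      ((rowB n k).map fun p => s p ^ kN p).prod).prod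

/-! Affine (twisted q-Yangian) machinery.  Series are treated coefficientwise. -/

/-- `z1 S r` is the coefficient matrix (in the first copy) of a series indexed by
nonnegative integers, extended by zero to `ℤ`. -/
def z1 {A : Type} [Ring A] {N : ℕ} (S : ℕ → Matrix (Fin N) (Fin N) A) (r : ℤ) :
    Matrix (Fin N × Fin N) (Fin N × Fin N) A :=
  if 0 ≤ r then amp1 (S r.toNat) else 0

def z2 {A : Type} [Ring A] {N : ℕ} (S : ℕ → Matrix (Fin N) (Fin N) A) (r : ℤ) :
    Matrix (Fin N × Fin N) (Fin N × Fin N) A :=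
  if 0 ≤ r then amp2 (S r.toNat) else 0

/-- Coefficient of `u^a v^b` in `R(u,v) S₁(u) Rᵗ(u⁻¹,v) S₂(v)`,
using `R(u,v) = u R̃ - v R` and `Rᵗ(u⁻¹,v) = u⁻¹ R̃ᵗ - v Rᵗ`. -/
def affLHS (F : Type) [Field F] (q : F) {N : ℕ} {A : Type} [Ring A] [Algebra F A]
    (S : ℕ → Matrix (Fin N) (Fin N) A) (a b : ℤ) :
    Matrix (Fin N × Fin N) (Fin N × Fin N) A :=
  liftF F (Rtil F q N) * z1 S (-a) * liftF F (Rtilt F q N) * z2 S (-b)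
    - liftF F (Rtil F q N) * z1 S (1 - a) * liftF F (Rct F q N) * z2 S (1 - b)
    - liftF F (Rc F q N) * z1 S (-1 - a) * liftF F (Rtilt F q N) * z2 S (1 - b)
    + liftF F (Rc F q N) * z1 S (-a) * liftF F (Rct F q N) * z2 S (2 - b)

/-- Coefficient of `u^a v^b` in `S₂(v) Rᵗ(u⁻¹,v) S₁(u) R(u,v)`. -/
def affRHS (F : Type) [Field F] (q : F) {N : ℕ} {A : Type} [Ring A] [Algebra F A]
    (S : ℕ → Matrix (Fin N) (Fin N) A) (a b : ℤ) :
    Matrix (Fin N × Fin N) (Fin N × Fin N) A :=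
  z2 S (-b) * liftF F (Rtilt F q N) * z1 S (-a) * liftF F (Rtil F q N)
    - z2 S (1 - b) * liftF F (Rtilt F q N) * z1 S (-1 - a) * liftF F (Rc F q N)
    - z2 S (1 - b) * liftF F (Rct F q N) * z1 S (1 - a) * liftF F (Rtil F q N)
    + z2 S (2 - b) * liftF F (Rct F q N) * z1 S (-a) * liftF F (Rc F q N)

def SfreeA (F : Type) [Field F] (N : ℕ) (r : ℕ) :
    Matrix (Fin N) (Fin N) (FreeAlgebra F (ℕ × Fin N × Fin N)) :=
  Matrix.of fun i j => FreeAlgebra.ι F (r, i, j)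

/-- Defining relations: only the affine reflection equation (coefficientwise). -/
inductive Rel9 (F : Type) [Field F] (q : F) (N : ℕ) :
    FreeAlgebra F (ℕ × Fin N × Fin N) → FreeAlgebra F (ℕ × Fin N × Fin N) → Prop
  | refl (a b : ℤ) (p r : Fin N × Fin N) :
      Rel9 F q N (affLHS F q (SfreeA F N) a b p r) (affRHS F q (SfreeA F N) a b p r)

abbrev Alg9 (F : Type) [Field F] (q : F) (N : ℕ) := RingQuot (Rel9 F q N)

def s9 (F : Type) [Field F] (q : F) (N : ℕ) (r : ℕ) (i j : Fin N) : Alg9 F q N :=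
  RingQuot.mkAlgHom F (Rel9 F q N) (FreeAlgebra.ι F (r, i, j))

/-- Defining relations of the presented twisted q-Yangian (orthogonal case). -/
inductive AORel (F : Type) [Field F] (q : F) (N : ℕ) :
    FreeAlgebra F (ℕ × Fin N × Fin N) → FreeAlgebra F (ℕ × Fin N × Fin N) → Prop
  | tri (i j : Fin N) (h : i < j) : AORel F q N (FreeAlgebra.ι F (0, i, j)) 0
  | diag (i : Fin N) : AORel F q N (FreeAlgebra.ι F (0, i, i)) 1
  | refl (a b : ℤ) (p r : Fin N × Fin N) :
      AORel F q N (affLHS F q (SfreeA F N) a b p r) (affRHS F q (SfreeA F N) a b p r)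

abbrev AlgAO (F : Type) [Field F] (q : F) (N : ℕ) := RingQuot (AORel F q N)

def sAO (F : Type) [Field F] (q : F) (N : ℕ) (r : ℕ) (i j : Fin N) : AlgAO F q N :=
  RingQuot.mkAlgHom F (AORel F q N) (FreeAlgebra.ι F (r, i, j))

/-- Lexicographic (non-strict) comparison of triples. -/
def tripLe (x y : ℕ × ℕ × ℕ) : Prop :=
  x.1 < y.1 ∨ (x.1 = y.1 ∧ (x.2.1 < y.2.1 ∨ (x.2.1 = y.2.1 ∧ x.2.2 ≤ y.2.2)))

/-- A list of generator indices `(r,i,j)` is ordered if it is weakly increasing with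
respect to the lexicographic order on `(r,i,j)`. -/
def sortedGens {N : ℕ} (l : List (ℕ × Fin N × Fin N)) : Prop :=
  l.Chain' fun x y => tripLe (x.1, x.2.1.val, x.2.2.val) (y.1, y.2.1.val, y.2.2.val)

/-! The quantum affine algebra `U_q(ĝl_N)` by its RTT presentation, coefficientwise. -/

abbrev AffGen (N : ℕ) := (ℕ × Fin N × Fin N) ⊕ (ℕ × Fin N × Fin N)

def TfA (F : Type) [Field F] (N : ℕ) (r : ℕ) :
    Matrix (Fin N) (Fin N) (FreeAlgebra F (AffGen N)) :=
  Matrix.of fun i j => FreeAlgebra.ι F (Sum.inl (r, i, j))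

def TbfA (F : Type) [Field F] (N : ℕ) (r : ℕ) :
    Matrix (Fin N) (Fin N) (FreeAlgebra F (AffGen N)) :=
  Matrix.of fun i j => FreeAlgebra.ι F (Sum.inr (r, i, j))

/-- Coefficient of `u^a v^b` in `R(u,v) X₁ Y₂` with prescribed coefficient extractions. -/
def affRttL (F : Type) [Field F] (q : F) {N : ℕ} {A : Type} [Ring A] [Algebra F A]
    (X Y : ℕ → Matrix (Fin N) (Fin N) A) (a b a' b' : ℤ) :
    Matrix (Fin N × Fin N) (Fin N × Fin N) A :=
  liftF F (Rtil F q N) * z1 X a * z2 Y b - liftF F (Rc F q N) * z1 X a' * z2 Y b'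

def affRttR (F : Type) [Field F] (q : F) {N : ℕ} {A : Type} [Ring A] [Algebra F A]
    (X Y : ℕ → Matrix (Fin N) (Fin N) A) (a b a' b' : ℤ) :
    Matrix (Fin N × Fin N) (Fin N × Fin N) A :=
  z2 Y b * z1 X a * liftF F (Rtil F q N) - z2 Y b' * z1 X a' * liftF F (Rc F q N)

inductive AffGlRel (F : Type) [Field F] (q : F) (N : ℕ) :
    FreeAlgebra F (AffGen N) → FreeAlgebra F (AffGen N) → Prop
  | t0_tri (i j : Fin N) (h : i < j) : AffGlRel F q N (TfA F N 0 i j) 0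
  | tb0_tri (i j : Fin N) (h : j < i) : AffGlRel F q N (TbfA F N 0 i j) 0
  | t_tb (i : Fin N) : AffGlRel F q N (TfA F N 0 i i * TbfA F N 0 i i) 1
  | tb_t (i : Fin N) : AffGlRel F q N (TbfA F N 0 i i * TfA F N 0 i i) 1
  | rtt (a b : ℤ) (p r : Fin N × Fin N) :
      AffGlRel F q N
        (affRttL F q (TfA F N) (TfA F N) (1 - a) (-b) (-a) (1 - b) p r)
        (affRttR F q (TfA F N) (TfA F N) (1 - a) (-b) (-a) (1 - b) p r)
  | rtbtb (a b : ℤ) (p r : Fin N × Fin N) :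
      AffGlRel F q N
        (affRttL F q (TbfA F N) (TbfA F N) (a - 1) b a (b - 1) p r)
        (affRttR F q (TbfA F N) (TbfA F N) (a - 1) b a (b - 1) p r)
  | rtbt (a b : ℤ) (p r : Fin N × Fin N) :
      AffGlRel F q N
        (affRttL F q (TbfA F N) (TfA F N) (a - 1) (-b) a (1 - b) p r)
        (affRttR F q (TbfA F N) (TfA F N) (a - 1) (-b) a (1 - b) p r)

/-- The quantum affine algebra `U_q(ĝl_N)`. -/
abbrev UqAff (F : Type) [Field F] (q : F) (N : ℕ) := RingQuot (AffGlRel F q N)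

def tA (F : Type) [Field F] (q : F) (N : ℕ) (r : ℕ) (i j : Fin N) : UqAff F q N :=
  RingQuot.mkAlgHom F (AffGlRel F q N) (FreeAlgebra.ι F (Sum.inl (r, i, j)))

def tbA (F : Type) [Field F] (q : F) (N : ℕ) (r : ℕ) (i j : Fin N) : UqAff F q N :=
  RingQuot.mkAlgHom F (AffGlRel F q N) (FreeAlgebra.ι F (Sum.inr (r, i, j)))

/-- Coefficient of `u^{-r}` in `s_ij(u) = Σ_a t_ia(u) t̄_ja(u⁻¹)`. -/
def Scoef (F : Type) [Field F] (q : F) (N : ℕ) (r : ℕ) (i j : Fin N) : UqAff F q N :=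
  ∑ a : Fin N, ∑ p ∈ Finset.range (r + 1), tA F q N p i a * tbA F q N (r - p) j a

/-- The twisted q-Yangian `Y^tw_q(o_N)` as a subalgebra of `U_q(ĝl_N)`. -/
def YtwO (F : Type) [Field F] (q : F) (N : ℕ) : Subalgebra F (UqAff F q N) :=
  Algebra.adjoin F {x | ∃ r i j, x = Scoef F q N r i j}

/-- Coefficient of `u^{-r}` in `s_ij(u)`, the `(i,j)` entry of `S(u) = T(u) G T̄(u⁻¹)ᵗ`
in the symplectic case. -/
def ScoefSp (F : Type) [Field F] (q : F) (n : ℕ) (r : ℕ) (i j : Fin (2 * n)) :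
    UqAff F q (2 * n) :=
  ∑ a : Fin n, ∑ p ∈ Finset.range (r + 1),
    (algebraMap F _ q * (tA F q (2 * n) p i (fe n a) * tbA F q (2 * n) (r - p) j (fo n a))
      - tA F q (2 * n) p i (fo n a) * tbA F q (2 * n) (r - p) j (fe n a))

/-- The twisted q-Yangian `Y^tw_q(sp_2n)` as a subalgebra of `U_q(ĝl_2n)`,
with a prescribed family of inverses of `s^{(0)}_{ii'}`. -/
def YtwSp (F : Type) [Field F] (q : F) (n : ℕ) (inv : Fin n → UqAff F q (2 * n)) :
    Subalgebra F (UqAff F q (2 * n)) :=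
  Algebra.adjoin F ({x | ∃ r i j, x = ScoefSp F q n r i j} ∪ Set.range inv)

abbrev ASpGen (n : ℕ) := (ℕ × Fin (2 * n) × Fin (2 * n)) ⊕ Fin n

def SfreeASp (F : Type) [Field F] (n : ℕ) (r : ℕ) :
    Matrix (Fin (2 * n)) (Fin (2 * n)) (FreeAlgebra F (ASpGen n)) :=
  Matrix.of fun i j => FreeAlgebra.ι F (Sum.inl (r, i, j))

/-- Defining relations of the presented twisted q-Yangian (symplectic case). -/
inductive ASpRel (F : Type) [Field F] (q : F) (n : ℕ) :
    FreeAlgebra F (ASpGen n) → FreeAlgebra F (ASpGen n) → Prop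
  | tri (i j : Fin (2 * n)) (h : i < j) (h' : ¬(i.val % 2 = 0 ∧ j.val = i.val + 1)) :
      ASpRel F q n (FreeAlgebra.ι F (Sum.inl (0, i, j))) 0
  | quad (k : Fin n) :
      ASpRel F q n
        (FreeAlgebra.ι F (Sum.inl (0, fo n k, fo n k)) *
          FreeAlgebra.ι F (Sum.inl (0, fe n k, fe n k)))
        (algebraMap F _ (q ^ 2) *
            (FreeAlgebra.ι F (Sum.inl (0, fo n k, fe n k)) *
              FreeAlgebra.ι F (Sum.inl (0, fe n k, fo n k)))
          + algebraMap F _ (q ^ 3))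
  | invR (k : Fin n) :
      ASpRel F q n
        (FreeAlgebra.ι F (Sum.inl (0, fe n k, fo n k)) * FreeAlgebra.ι F (Sum.inr k)) 1
  | invL (k : Fin n) :
      ASpRel F q n
        (FreeAlgebra.ι F (Sum.inr k) * FreeAlgebra.ι F (Sum.inl (0, fe n k, fo n k))) 1
  | refl (a b : ℤ) (p r : Fin (2 * n) × Fin (2 * n)) :
      ASpRel F q n (affLHS F q (SfreeASp F n) a b p r) (affRHS F q (SfreeASp F n) a b p r)

abbrev AlgASp (F : Type) [Field F] (q : F) (n : ℕ) := RingQuot (ASpRel F q n)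

def sASp (F : Type) [Field F] (q : F) (n : ℕ) (r : ℕ) (i j : Fin (2 * n)) : AlgASp F q n :=
  RingQuot.mkAlgHom F (ASpRel F q n) (FreeAlgebra.ι F (Sum.inl (r, i, j)))

def sInvASp (F : Type) [Field F] (q : F) (n : ℕ) (k : Fin n) : AlgASp F q n :=
  RingQuot.mkAlgHom F (ASpRel F q n) (FreeAlgebra.ι F (Sum.inr k))

/-! q-antisymmetrizer and Sklyanin/quantum determinant machinery. -/

/-- The trigonometric R-matrix `R(u,v)`. -/
def Rtrig (F : Type) [Field F] (q : F) (N : ℕ) (u v : F) :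
    Matrix (Fin N × Fin N) (Fin N × Fin N) F := Matrix.of fun p r =>
  (if p = r then (if p.1 = p.2 then q⁻¹ * u - q * v else u - v) else 0)
  + (if p.1 = r.2 ∧ p.2 = r.1 ∧ p.1 ≠ p.2 then
      (q⁻¹ - q) * (if p.2 < p.1 then u else v) else 0)

/-- An operator on `ℂ^N ⊗ ℂ^N` acting in the `i`-th and `j`-th factors of `(ℂ^N)^{⊗ r}`. -/
def big2 (F : Type) [Field F] {N r : ℕ} (i j : Fin r)
    (M : Matrix (Fin N × Fin N) (Fin N × Fin N) F) :
    Matrix (Fin r → Fin N) (Fin r → Fin N) F :=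
  Matrix.of fun f g =>
    if ∀ k, k ≠ i → k ≠ j → f k = g k then M (f i, f j) (g i, g j) else 0

/-- The list of the pairs `(i,j)`, `i < j`, in lexicographic order. -/
def pairsLex (r : ℕ) : List (Fin r × Fin r) :=
  (List.finRange r).flatMap fun i =>
    ((List.finRange r).filter fun j => i < j).map fun j => (i, j)

/-- The number of inversions (the Coxeter length) of a permutation. -/
def invCount {r : ℕ} (σ : Equiv.Perm (Fin r)) : ℕ :=
  (Finset.univ.filter fun p : Fin r × Fin r => p.1 < p.2 ∧ σ p.2 < σ p.1).card

/-- The q-permutation operator `P^q` on `ℂ^N ⊗ ℂ^N`. -/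
def PqSmall (F : Type) [Field F] (q : F) (N : ℕ) :
    Matrix (Fin N × Fin N) (Fin N × Fin N) F := Matrix.of fun p r =>
  if r.1 = p.2 ∧ r.2 = p.1 then (if p.1 = p.2 then 1 else if p.2 < p.1 then q else q⁻¹)
  else 0

/-- The hypothesis that `Pq` is the extension of the q-permutation operators along
reduced decompositions: `P^q_{σ s_i} = P^q_σ P^q_{s_i}` whenever the length grows. -/
def PqExt (F : Type) [Field F] (q : F) (N r : ℕ)
    (Pq : Equiv.Perm (Fin r) → Matrix (Fin r → Fin N) (Fin r → Fin N) F) : Prop :=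
  Pq 1 = 1 ∧
    ∀ (σ : Equiv.Perm (Fin r)) (i : ℕ) (h : i + 1 < r),
      invCount (σ * Equiv.swap ⟨i, Nat.lt_of_succ_lt h⟩ ⟨i + 1, h⟩) = invCount σ + 1 →
        Pq (σ * Equiv.swap ⟨i, Nat.lt_of_succ_lt h⟩ ⟨i + 1, h⟩) =
          Pq σ * big2 F ⟨i, Nat.lt_of_succ_lt h⟩ ⟨i + 1, h⟩ (PqSmall F q N)

/-- The q-antisymmetrizer `A^q_r = Σ_σ sgn(σ) P^q_σ`. -/
def AqM (F : Type) [Field F] {N r : ℕ}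
    (Pq : Equiv.Perm (Fin r) → Matrix (Fin r → Fin N) (Fin r → Fin N) F) :
    Matrix (Fin r → Fin N) (Fin r → Fin N) F :=
  ∑ σ : Equiv.Perm (Fin r), ((Equiv.Perm.sign σ : ℤ) : F) • Pq σ

/-- A matrix acting in the `k`-th factor of `(ℂ^N)^{⊗ N}`, with entries in `A`. -/
def ampAt {A : Type} [Ring A] {N : ℕ} (k : Fin N) (M : Matrix (Fin N) (Fin N) A) :
    Matrix (Fin N → Fin N) (Fin N → Fin N) A :=
  Matrix.of fun f g => if ∀ l, l ≠ k → f l = g l then M (f k) (g k) else 0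

/-- A scalar two-site operator viewed over `A`, acting at sites `i`, `j`. -/
def big2A (F : Type) [Field F] {A : Type} [Ring A] [Algebra F A] {N : ℕ} (i j : Fin N)
    (M : Matrix (Fin N × Fin N) (Fin N × Fin N) F) :
    Matrix (Fin N → Fin N) (Fin N → Fin N) A :=
  (big2 F i j M).map (algebraMap F A)

/-- Coefficient of `u^m` in a product of formal series, each of which is supported in
degrees `≤ 1`; the series are given by their coefficient functions `ℤ → M`. -/
def seriesProdCoeff {M : Type} [Ring M] : List (ℤ → M) → ℤ → M
  | [], m => if m = 0 then 1 else 0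
  | c :: t, m => ∑ k ∈ Finset.Icc (m - t.length) 1, c k * seriesProdCoeff t (m - k)

/-! Series factors entering the Sklyanin determinant. -/

/-- The matrix `S^{(r)}` of the coefficients of `S(u)` (orthogonal case). -/
def SmatA (F : Type) [Field F] (q : F) (N : ℕ) (r : ℕ) :
    Matrix (Fin N) (Fin N) (UqAff F q N) :=
  Matrix.of fun i j => Scoef F q N r i j

/-- The series `S_k(q^{-2k+2} u)` acting at site `k` (0-based `k`), coefficientwise. -/
def SfacO (F : Type) [Field F] (q : F) (N : ℕ) (k : Fin N) (m : ℤ) :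
    Matrix (Fin N → Fin N) (Fin N → Fin N) (UqAff F q N) :=
  if m ≤ 0 then q ^ (2 * (k.val : ℤ) * (-m)) • ampAt k (SmatA F q N (-m).toNat) else 0

/-- The series `R_{ij}ᵗ((q^{-2i+2}u)⁻¹, q^{-2j+2}u)` (0-based `i`, `j`), coefficientwise. -/
def RtfacO (F : Type) [Field F] (q : F) (N : ℕ) (i j : Fin N) (m : ℤ) :
    Matrix (Fin N → Fin N) (Fin N → Fin N) (UqAff F q N) :=
  if m = -1 then q ^ (2 * (i.val : ℤ)) • big2A F i j (Rtilt F q N)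
  else if m = 1 then (-(q ^ (-2 * (j.val : ℤ)))) • big2A F i j (Rct F q N)
  else 0

/-- The ordered list of factors `S₁(u) R₁₂ᵗ ⋯ R₁Nᵗ S₂(q⁻²u) ⋯ S_N(q^{-2N+2}u)`. -/
def sdetFacsO (F : Type) [Field F] (q : F) (N : ℕ) :
    List (ℤ → Matrix (Fin N → Fin N) (Fin N → Fin N) (UqAff F q N)) :=
  (List.finRange N).flatMap fun i =>
    SfacO F q N i :: (((List.finRange N).filter fun j => i < j).map fun j => RtfacO F q N i j)

/-- The matrix `S^{(r)}` of the coefficients of `S(u)` (symplectic case). -/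
def SmatASp (F : Type) [Field F] (q : F) (n : ℕ) (r : ℕ) :
    Matrix (Fin (2 * n)) (Fin (2 * n)) (UqAff F q (2 * n)) :=
  Matrix.of fun i j => ScoefSp F q n r i j

def SfacSp (F : Type) [Field F] (q : F) (n : ℕ) (k : Fin (2 * n)) (m : ℤ) :
    Matrix (Fin (2 * n) → Fin (2 * n)) (Fin (2 * n) → Fin (2 * n)) (UqAff F q (2 * n)) :=
  if m ≤ 0 then q ^ (2 * (k.val : ℤ) * (-m)) • ampAt k (SmatASp F q n (-m).toNat) else 0

def sdetFacsSp (F : Type) [Field F] (q : F) (n : ℕ) :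
    List (ℤ → Matrix (Fin (2 * n) → Fin (2 * n)) (Fin (2 * n) → Fin (2 * n))
      (UqAff F q (2 * n))) :=
  (List.finRange (2 * n)).flatMap fun i =>
    SfacSp F q n i ::
      (((List.finRange (2 * n)).filter fun j => i < j).map fun j => RtfacO F q (2 * n) i j)

/-- Coefficientwise quantum determinant `qdet T(u)`:
the coefficient of `u^m` (nonzero only for `m ≤ 0`). -/
def qdetTc (F : Type) [Field F] (q : F) (N : ℕ) (m : ℤ) : UqAff F q N :=
  if m ≤ 0 then
    ∑ σ : Equiv.Perm (Fin N), ∑ rv ∈ Finset.Nat.antidiagonalTuple N (-m).toNat,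
      (((-q)⁻¹ ^ invCount σ) * ∏ k : Fin N, q ^ (2 * (k.val : ℤ) * (rv k : ℤ))) •
        ((List.finRange N).map fun k => tA F q N (rv k) (σ k) k).prod
  else 0

/-- Coefficientwise quantum determinant `qdet T̄(q^{2N-2} u⁻¹)`:
the coefficient of `u^m` (nonzero only for `m ≤ 0`). -/
def qdetTbc (F : Type) [Field F] (q : F) (N : ℕ) (m : ℤ) : UqAff F q N :=
  if m ≤ 0 then
    ∑ σ : Equiv.Perm (Fin N), ∑ rv ∈ Finset.Nat.antidiagonalTuple N (-m).toNat,
      (((-q)⁻¹ ^ invCount σ) *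
          ∏ k : Fin N, q ^ ((2 * (N : ℤ) - 2 - 2 * (k.val : ℤ)) * (rv k : ℤ))) •
        ((List.finRange N).map fun k => tbA F q N (rv k) (σ k) k).prod
  else 0

/-- The linear factor `q^{2i-2}u⁻¹ - q^{-2j+2}u` of `γ_N(u)` (0-based `i`, `j`),
viewed as an `A`-valued series. -/
def gamFac (F : Type) [Field F] (q : F) (N : ℕ) (p : Fin N × Fin N) (m : ℤ) : UqAff F q N :=
  if m = -1 then algebraMap F _ (q ^ (2 * (p.1.val : ℤ)))
  else if m = 1 then algebraMap F _ (-(q ^ (-2 * (p.2.val : ℤ)))) else 0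

/-- The list of series whose product is `γ_N(u) qdet T(u) qdet T̄(q^{2N-2}u⁻¹)`
in the orthogonal case. -/
def rhsO (F : Type) [Field F] (q : F) (N : ℕ) : List (ℤ → UqAff F q N) :=
  ((pairsLex N).map fun p => gamFac F q N p) ++ [qdetTc F q N, qdetTbc F q N]

/-- The diagonal coefficient of `Rc`. -/
def Rdiag {F : Type} [Field F] (q : F) {N : ℕ} (i j : Fin N) : F := if i = j then q else 1

/-- The off-diagonal coefficient of `Rc`. -/
def Roff {F : Type} [Field F] (q : F) {N : ℕ} (i j : Fin N) : F := if i < j then q - q⁻¹ else 0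

lemma Rdiag_comm {F : Type} [Field F] (q : F) {N : ℕ} (i j : Fin N) :
    Rdiag q i j = Rdiag q j i := by
  simp only [Rdiag, eq_comm]

section Entries

variable {F : Type} [Field F] {q : F} {N : ℕ} {A : Type} [Ring A] [Algebra F A]

lemma Rc_apply (p r : Fin N × Fin N) :
    Rc F q N p r = (if r = p then Rdiag q p.1 p.2 else 0)
      + (if r = p.swap then Roff q p.1 p.2 else 0) := by
  obtain ⟨i, j⟩ := p
  obtain ⟨k, l⟩ := r
  simp only [Rc, Rdiag, Roff, Matrix.of_apply, Prod.swap_prod_mk, Prod.mk.injEq]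
  congr 1
  · simp only [eq_comm]
  · split_ifs <;> grind

lemma Rc_apply' (p r : Fin N × Fin N) :
    Rc F q N p r = (if p = r then Rdiag q r.1 r.2 else 0)
      + (if p = r.swap then Roff q r.2 r.1 else 0) := by
  obtain ⟨i, j⟩ := p
  obtain ⟨k, l⟩ := r
  simp only [Rc, Rdiag, Roff, Matrix.of_apply, Prod.swap_prod_mk, Prod.mk.injEq]
  congr 1 <;> split_ifs <;> grind

lemma liftF_Rc_mul_apply {m : Type} (M : Matrix (Fin N × Fin N) m A) (i j : Fin N) (r : m) :
    ((liftF F (Rc F q N) : Matrix _ _ A) * M) (i, j) r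
      = Rdiag q i j • M (i, j) r + Roff q i j • M (j, i) r := by
  simp [Matrix.mul_apply, liftF, Rc_apply, add_mul, Finset.sum_add_distrib,
    apply_ite (algebraMap F A), ite_mul, Algebra.smul_def]

lemma mul_liftF_Rc_apply {m : Type} (M : Matrix m (Fin N × Fin N) A) (r : m) (a b : Fin N) :
    (M * (liftF F (Rc F q N) : Matrix _ _ A)) r (a, b)
      = Rdiag q a b • M r (a, b) + Roff q b a • M r (b, a) := by
  simp [Matrix.mul_apply, liftF, Rc_apply', mul_add, Finset.sum_add_distrib,
    apply_ite (algebraMap F A), mul_ite, Algebra.smul_def, Algebra.commutes]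

lemma amp1_mul_amp2_apply (X Y : Matrix (Fin N) (Fin N) A) (i j a b : Fin N) :
    (amp1 X * amp2 Y) (i, j) (a, b) = X i a * Y j b := by
  simp [Matrix.mul_apply, amp1, amp2, Fintype.sum_prod_type]

lemma amp2_mul_amp1_apply (X Y : Matrix (Fin N) (Fin N) A) (i j a b : Fin N) :
    (amp2 Y * amp1 X) (i, j) (a, b) = Y j b * X i a := by
  simp [Matrix.mul_apply, amp1, amp2, Fintype.sum_prod_type]

lemma amp1_Rct_amp2_apply (X Y : Matrix (Fin N) (Fin N) A) (i j a b : Fin N) :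
    (amp1 X * (liftF F (Rct F q N) : Matrix _ _ A) * amp2 Y) (i, j) (a, b)
      = Rdiag q a j • (X i a * Y j b) + Roff q a j • (X i j * Y a b) := by
  have h : ∀ k l, (amp1 X * (liftF F (Rct F q N) : Matrix _ _ A)) (i, j) (k, l)
      = (if l = j then Rdiag q k j • X i k else 0) + if l = k then Roff q k j • X i j else 0 := by
    intro k l
    simp [Matrix.mul_apply, amp1, Fintype.sum_prod_type, liftF, Rct, Rc_apply, mul_add,
      Finset.sum_add_distrib, apply_ite (algebraMap F A), ite_mul, mul_ite, ite_and,
      Algebra.smul_def, Algebra.commutes]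
    split_ifs <;> simp_all
  simp [Matrix.mul_apply, h, amp2, Fintype.sum_prod_type, add_mul, Finset.sum_add_distrib,
    ite_mul]

lemma amp2_Rct_amp1_apply (X Y : Matrix (Fin N) (Fin N) A) (i j a b : Fin N) :
    (amp2 Y * (liftF F (Rct F q N) : Matrix _ _ A) * amp1 X) (i, j) (a, b)
      = Rdiag q i b • (Y j b * X i a) + Roff q b i • (Y j i * X b a) := by
  have h : ∀ k l, (amp2 Y * (liftF F (Rct F q N) : Matrix _ _ A)) (i, j) (k, l)
      = (if k = i then Rdiag q i l • Y j l else 0) + if k = l then Roff q l i • Y j i else 0 := by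
    intro k l
    simp [Matrix.mul_apply, amp2, Fintype.sum_prod_type, liftF, Rct, Rc_apply', mul_add,
      Finset.sum_add_distrib, apply_ite (algebraMap F A), ite_mul, mul_ite, ite_and,
      Algebra.smul_def, Algebra.commutes]
    split_ifs <;> simp_all
  simp [Matrix.mul_apply, h, amp1, Fintype.sum_prod_type, add_mul, Finset.sum_add_distrib,
    ite_mul]

lemma reflLHS_apply (S : Matrix (Fin N) (Fin N) A) (i j a b : Fin N) :
    reflLHS F q S (i, j) (a, b)
      = Rdiag q i j • (Rdiag q a j • (S i a * S j b) + Roff q a j • (S i j * S a b))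
        + Roff q i j • (Rdiag q a i • (S j a * S i b) + Roff q a i • (S j i * S a b)) := by
  rw [reflLHS, Matrix.mul_assoc, Matrix.mul_assoc, liftF_Rc_mul_apply, ← Matrix.mul_assoc,
    amp1_Rct_amp2_apply, amp1_Rct_amp2_apply]

lemma reflRHS_apply (S : Matrix (Fin N) (Fin N) A) (i j a b : Fin N) :
    reflRHS F q S (i, j) (a, b)
      = Rdiag q a b • (Rdiag q i b • (S j b * S i a) + Roff q b i • (S j i * S b a))
        + Roff q b a • (Rdiag q i a • (S j a * S i b) + Roff q a i • (S j i * S a b)) := by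
  rw [reflRHS, mul_liftF_Rc_apply, amp2_Rct_amp1_apply, amp2_Rct_amp1_apply]

lemma rttLHS_apply (X Y : Matrix (Fin N) (Fin N) A) (i j a b : Fin N) :
    rttLHS F q X Y (i, j) (a, b)
      = Rdiag q i j • (X i a * Y j b) + Roff q i j • (X j a * Y i b) := by
  rw [rttLHS, Matrix.mul_assoc, liftF_Rc_mul_apply, amp1_mul_amp2_apply, amp1_mul_amp2_apply]

lemma rttRHS_apply (X Y : Matrix (Fin N) (Fin N) A) (i j a b : Fin N) :
    rttRHS F q X Y (i, j) (a, b)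
      = Rdiag q a b • (Y j b * X i a) + Roff q b a • (Y j a * X i b) := by
  rw [rttRHS, mul_liftF_Rc_apply, amp2_mul_amp1_apply, amp2_mul_amp1_apply]

variable {B : Type} [Ring B] [Algebra F B] (f : A →ₐ[F] B)

lemma map_reflLHS_apply (S : Matrix (Fin N) (Fin N) A) (p r : Fin N × Fin N) :
    f (reflLHS F q S p r) = reflLHS F q (S.map f) p r := by
  obtain ⟨i, j⟩ := p
  obtain ⟨a, b⟩ := r
  simp [reflLHS_apply]

lemma map_reflRHS_apply (S : Matrix (Fin N) (Fin N) A) (p r : Fin N × Fin N) :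
    f (reflRHS F q S p r) = reflRHS F q (S.map f) p r := by
  obtain ⟨i, j⟩ := p
  obtain ⟨a, b⟩ := r
  simp [reflRHS_apply]

lemma map_rttLHS_apply (X Y : Matrix (Fin N) (Fin N) A) (p r : Fin N × Fin N) :
    f (rttLHS F q X Y p r) = rttLHS F q (X.map f) (Y.map f) p r := by
  obtain ⟨i, j⟩ := p
  obtain ⟨a, b⟩ := r
  simp [rttLHS_apply]

lemma map_rttRHS_apply (X Y : Matrix (Fin N) (Fin N) A) (p r : Fin N × Fin N) :
    f (rttRHS F q X Y p r) = rttRHS F q (X.map f) (Y.map f) p r := by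
  obtain ⟨i, j⟩ := p
  obtain ⟨a, b⟩ := r
  simp [rttRHS_apply]

lemma amp1_mul (X Y : Matrix (Fin N) (Fin N) A) : amp1 (X * Y) = amp1 X * amp1 Y := by
  ext ⟨i, j⟩ ⟨a, b⟩
  by_cases h : j = b <;> simp [Matrix.mul_apply, amp1, Fintype.sum_prod_type, h]

lemma amp2_mul (X Y : Matrix (Fin N) (Fin N) A) : amp2 (X * Y) = amp2 X * amp2 Y := by
  ext ⟨i, j⟩ ⟨a, b⟩
  by_cases h : i = a <;> simp [Matrix.mul_apply, amp2, Fintype.sum_prod_type, h]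

lemma amp1_mul_amp2_comm {X Y : Matrix (Fin N) (Fin N) A}
    (h : ∀ i j k l, Commute (X i j) (Y k l)) : amp1 X * amp2 Y = amp2 Y * amp1 X := by
  ext ⟨i, j⟩ ⟨a, b⟩
  rw [amp1_mul_amp2_apply, amp2_mul_amp1_apply, (h _ _ _ _).eq]

open Matrix in
/-- If `T`, `T̄` satisfy the `RTT`-relations and the scalar matrix `G` satisfies the reflection
equation, then so does `T G T̄ᵗ`. -/
theorem reflection_of_rtt {T Tb : Matrix (Fin N) (Fin N) A} {G : Matrix (Fin N) (Fin N) F}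
    (hT : rttLHS F q T T = rttRHS F q T T) (hTb : rttLHS F q Tb Tb = rttRHS F q Tb Tb)
    (hTbT : rttLHS F q Tb T = rttRHS F q Tb T) (hG : reflLHS F q G = reflRHS F q G) :
    reflLHS F q (T * liftF F G * Tbᵀ) = reflRHS F q (T * liftF F G * Tbᵀ) := by
  set R : Matrix _ _ A := liftF F (Rc F q N) with hR
  set Rt : Matrix _ _ A := liftF F (Rct F q N) with hRt
  set H : Matrix _ _ A := liftF F G with hH
  have hcomm : ∀ M : Matrix (Fin N) (Fin N) A, ∀ i j k l, Commute (H i j) (M k l) :=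
    fun M i j k l => Algebra.commute_algebraMap_left _ _
  have h1 : amp1 Tbᵀ * Rt * amp2 T = amp2 T * Rt * amp1 Tbᵀ := by
    ext ⟨x, y⟩ ⟨a, b⟩
    rw [hRt, amp1_Rct_amp2_apply, amp2_Rct_amp1_apply]
    have := congr_fun₂ hTbT (a, y) (x, b)
    rwa [rttLHS_apply, rttRHS_apply] at this
  have h2 : R * (amp1 Tbᵀ * amp2 Tbᵀ) = amp2 Tbᵀ * amp1 Tbᵀ * R := by
    ext ⟨i, j⟩ ⟨a, b⟩
    rw [hR, liftF_Rc_mul_apply, mul_liftF_Rc_apply, amp1_mul_amp2_apply, amp1_mul_amp2_apply,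
      amp2_mul_amp1_apply, amp2_mul_amp1_apply]
    have := congr_fun₂ hTb (b, a) (j, i)
    rw [rttLHS_apply, rttRHS_apply] at this
    simp only [transpose_apply]
    rw [Rdiag_comm q i j, Rdiag_comm q a b]
    exact this.symm
  have h3 : R * amp1 H * Rt * amp2 H = amp2 H * Rt * amp1 H * R := by
    ext ⟨i, j⟩ ⟨a, b⟩
    change reflLHS F q H (i, j) (a, b) = reflRHS F q H (i, j) (a, b)
    have := congrArg (Algebra.ofId F A) (congr_fun₂ hG (i, j) (a, b))
    rwa [map_reflLHS_apply, map_reflRHS_apply] at this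
  have h7 : amp1 T * Rt * amp2 Tbᵀ = amp2 Tbᵀ * Rt * amp1 T := by
    ext ⟨i, j⟩ ⟨a, b⟩
    rw [hRt, amp1_Rct_amp2_apply, amp2_Rct_amp1_apply]
    have := congr_fun₂ hTbT (b, i) (j, a)
    rw [rttLHS_apply, rttRHS_apply] at this
    simp only [transpose_apply]
    rw [Rdiag_comm q a j, Rdiag_comm q i b]
    exact this.symm
  have h4 : R * amp1 T * amp2 T = amp2 T * amp1 T * R := hT
  have h5 := amp1_mul_amp2_comm (hcomm T)
  have h6 := (amp1_mul_amp2_comm (fun i j k l => (hcomm Tbᵀ k l i j).symm))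
  rw [reflLHS, reflRHS, ← hR, ← hRt]
  simp only [amp1_mul, amp2_mul]
  calc _ = R * amp1 T * amp1 H * (amp1 Tbᵀ * Rt * amp2 T) * amp2 H * amp2 Tbᵀ := by noncomm_ring
    _ = R * amp1 T * (amp1 H * amp2 T) * Rt * (amp1 Tbᵀ * amp2 H) * amp2 Tbᵀ := by
      rw [h1]; noncomm_ring
    _ = (R * amp1 T * amp2 T) * amp1 H * Rt * amp2 H * amp1 Tbᵀ * amp2 Tbᵀ := by
      rw [h5, h6]; noncomm_ring
    _ = amp2 T * amp1 T * (R * amp1 H * Rt * amp2 H) * amp1 Tbᵀ * amp2 Tbᵀ := by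
      rw [h4]; noncomm_ring
    _ = amp2 T * (amp1 T * amp2 H) * Rt * amp1 H * (R * (amp1 Tbᵀ * amp2 Tbᵀ)) := by
      rw [h3]; noncomm_ring
    _ = amp2 T * amp2 H * (amp1 T * Rt * (amp1 H * amp2 Tbᵀ)) * amp1 Tbᵀ * R := by
      rw [h2, amp1_mul_amp2_comm (fun i j k l => (hcomm T k l i j).symm)]; noncomm_ring
    _ = amp2 T * amp2 H * (amp1 T * Rt * amp2 Tbᵀ) * amp1 H * amp1 Tbᵀ * R := by
      rw [amp1_mul_amp2_comm (hcomm Tbᵀ)]; noncomm_ring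
    _ = _ := by rw [h7]; noncomm_ring

end Entries

section Pairs

variable {F : Type} [Field F] {q : F} {N : ℕ} {A : Type} [Ring A] [Algebra F A]

/-- The matrices `T`, `T̄` over an `F`-algebra satisfy the defining relations of `U_q(gl_N)`. -/
structure IsGlPair (q : F) (T Tb : Matrix (Fin N) (Fin N) A) : Prop where
  t_zero : ∀ i j, i < j → T i j = 0
  tb_zero : ∀ i j, j < i → Tb i j = 0
  t_tb : ∀ i, T i i * Tb i i = 1
  tb_t : ∀ i, Tb i i * T i i = 1
  rtt : rttLHS F q T T = rttRHS F q T T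
  rtbtb : rttLHS F q Tb Tb = rttRHS F q Tb Tb
  rtbt : rttLHS F q Tb T = rttRHS F q Tb T

lemma isGlPair_gen (q : F) (N : ℕ) :
    IsGlPair q (Matrix.of (tE F q N)) (Matrix.of (tbE F q N)) := by
  have hr {x y} (h : GlRel F q N x y) := RingQuot.mkAlgHom_rel F h
  have hT : Matrix.of (tE F q N) = (Tfree F N).map (RingQuot.mkAlgHom F (GlRel F q N)) := rfl
  have hTb : Matrix.of (tbE F q N) = (Tbfree F N).map (RingQuot.mkAlgHom F (GlRel F q N)) := rfl
  refine ⟨fun i j h => ?_, fun i j h => ?_, fun i => ?_, fun i => ?_, ?_, ?_, ?_⟩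
  · exact (hr (.t_zero i j h)).trans (map_zero _)
  · exact (hr (.tb_zero i j h)).trans (map_zero _)
  · exact (map_mul _ _ _).symm.trans ((hr (.t_tb i)).trans (map_one _))
  · exact (map_mul _ _ _).symm.trans ((hr (.tb_t i)).trans (map_one _))
  · ext p r
    simpa only [hT, map_rttLHS_apply, map_rttRHS_apply] using hr (.rtt p r)
  · ext p r
    simpa only [hTb, map_rttLHS_apply, map_rttRHS_apply] using hr (.rtbtb p r)
  · ext p r
    simpa only [hT, hTb, map_rttLHS_apply, map_rttRHS_apply] using hr (.rtbt p r)

/-- The representation of `U_q(gl_N)` determined by a pair of matrices. -/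
def IsGlPair.lift {T Tb : Matrix (Fin N) (Fin N) A} (h : IsGlPair q T Tb) : UqGl F q N →ₐ[F] A :=
  RingQuot.liftAlgHom F ⟨FreeAlgebra.lift F
    (Sum.elim (fun p => T p.1 p.2) (fun p => Tb p.1 p.2)), by
    have hT : (Tfree F N).map (FreeAlgebra.lift F
        (Sum.elim (fun p => T p.1 p.2) (fun p => Tb p.1 p.2))) = T := by
      ext i j; simp [Tfree]
    have hTb : (Tbfree F N).map (FreeAlgebra.lift F
        (Sum.elim (fun p => T p.1 p.2) (fun p => Tb p.1 p.2))) = Tb := by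
      ext i j; simp [Tbfree]
    intro x y hxy
    cases hxy with
    | t_zero i j hij => simpa [Tfree] using h.t_zero i j hij
    | tb_zero i j hij => simpa [Tbfree] using h.tb_zero i j hij
    | t_tb i => simpa [Tfree, Tbfree] using h.t_tb i
    | tb_t i => simpa [Tfree, Tbfree] using h.tb_t i
    | rtt p r => rw [map_rttLHS_apply, map_rttRHS_apply, hT, h.rtt]
    | rtbtb p r => rw [map_rttLHS_apply, map_rttRHS_apply, hTb, h.rtbtb]
    | rtbt p r => rw [map_rttLHS_apply, map_rttRHS_apply, hT, hTb, h.rtbt]⟩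

@[simp]
lemma IsGlPair.lift_tE {T Tb : Matrix (Fin N) (Fin N) A} (h : IsGlPair q T Tb) (i j : Fin N) :
    h.lift (tE F q N i j) = T i j := by
  simp [lift, tE]

@[simp]
lemma IsGlPair.lift_tbE {T Tb : Matrix (Fin N) (Fin N) A} (h : IsGlPair q T Tb) (i j : Fin N) :
    h.lift (tbE F q N i j) = Tb i j := by
  simp [lift, tbE]

variable {n : ℕ}

/-- The matrix `S` and the elements `u` of an `F`-algebra satisfy the defining relations of the
presented algebra `𝒮`. -/
structure IsSpPair (q : F) (S : Matrix (Fin (2 * n)) (Fin (2 * n)) A) (u : Fin n → A) : Prop where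
  tri : ∀ i j, i < j → ¬(i.val % 2 = 0 ∧ j.val = i.val + 1) → S i j = 0
  quad : ∀ k, S (fo n k) (fo n k) * S (fe n k) (fe n k)
    = algebraMap F A (q ^ 2) * (S (fo n k) (fe n k) * S (fe n k) (fo n k))
      + algebraMap F A (q ^ 3)
  invR : ∀ k, S (fe n k) (fo n k) * u k = 1
  invL : ∀ k, u k * S (fe n k) (fo n k) = 1
  refl : reflLHS F q S = reflRHS F q S

lemma isSpPair_gen (q : F) (n : ℕ) :
    IsSpPair q (Matrix.of (sSpP F q n)) (sInvP F q n) := by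
  have hr {x y} (h : SpRel F q n x y) := RingQuot.mkAlgHom_rel F h
  have hS : Matrix.of (sSpP F q n) = (SpFreeS F n).map (RingQuot.mkAlgHom F (SpRel F q n)) := rfl
  refine ⟨fun i j h h' => ?_, fun k => ?_, fun k => ?_, fun k => ?_, ?_⟩
  · exact (hr (.tri i j h h')).trans (map_zero _)
  · have := hr (.quad k)
    rw [map_add, map_mul, map_mul, map_mul, AlgHom.commutes, AlgHom.commutes] at this
    exact this
  · exact (map_mul _ _ _).symm.trans ((hr (.invR k)).trans (map_one _))
  · exact (map_mul _ _ _).symm.trans ((hr (.invL k)).trans (map_one _))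
  · ext p r
    simpa only [hS, map_reflLHS_apply, map_reflRHS_apply] using hr (.refl p r)

/-- The homomorphism from the presented algebra `𝒮` determined by a solution of its relations. -/
def IsSpPair.lift {S : Matrix (Fin (2 * n)) (Fin (2 * n)) A} {u : Fin n → A}
    (h : IsSpPair q S u) : AlgSp F q n →ₐ[F] A :=
  RingQuot.liftAlgHom F ⟨FreeAlgebra.lift F (Sum.elim (fun p => S p.1 p.2) u), by
    have hS : (SpFreeS F n).map (FreeAlgebra.lift F (Sum.elim (fun p => S p.1 p.2) u)) = S := by
      ext i j; simp [SpFreeS]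
    intro x y hxy
    cases hxy with
    | tri i j h₁ h₂ => simpa using h.tri i j h₁ h₂
    | quad k =>
      rw [map_add, map_mul, map_mul, map_mul, AlgHom.commutes, AlgHom.commutes]
      simpa using h.quad k
    | invR k => simpa using h.invR k
    | invL k => simpa using h.invL k
    | refl p r => rw [map_reflLHS_apply, map_reflRHS_apply, hS, h.refl]⟩

@[simp]
lemma IsSpPair.lift_sSpP {S : Matrix (Fin (2 * n)) (Fin (2 * n)) A} {u : Fin n → A}
    (h : IsSpPair q S u) (i j : Fin (2 * n)) : h.lift (sSpP F q n i j) = S i j := by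
  simp [lift, sSpP]

@[simp]
lemma IsSpPair.lift_sInvP {S : Matrix (Fin (2 * n)) (Fin (2 * n)) A} {u : Fin n → A}
    (h : IsSpPair q S u) (k : Fin n) : h.lift (sInvP F q n k) = u k := by
  simp [lift, sInvP]

lemma adjoin_spGen (q : F) (n : ℕ) :
    Algebra.adjoin F ({x | ∃ i j, x = sSpP F q n i j} ∪ Set.range (sInvP F q n)) = ⊤ := by
  have h := congrArg (Subalgebra.map (RingQuot.mkAlgHom F (SpRel F q n)))
    (FreeAlgebra.adjoin_range_ι F (SpGen n))
  rw [Algebra.map_top, AlgHom.map_adjoin, (AlgHom.range_eq_top _).2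
    (RingQuot.mkAlgHom_surjective F _)] at h
  rw [← h, ← Set.range_comp]
  congr 1
  ext x
  simp only [Set.mem_union, Set.mem_ofPred_eq, Set.mem_range, Function.comp_apply, Sum.exists,
    Prod.exists, sSpP, sInvP, eq_comm]

/-- The index pairing `i ↦ i'` of the symplectic form. -/
def pairIdx (i : Fin (2 * n)) : Fin (2 * n) :=
  ⟨if i.val % 2 = 0 then i.val + 1 else i.val - 1, by have := i.isLt; split_ifs <;> omega⟩

/-- The nonzero coefficient in row `i` of the matrix `G`. -/
def gCoef {R : Type*} [CommRing R] (q : R) (i : Fin (2 * n)) : R := if i.val % 2 = 0 then q else -1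

/-- The matrix `G` of the `q`-symplectic form. -/
def gMat (q : F) (n : ℕ) : Matrix (Fin (2 * n)) (Fin (2 * n)) F :=
  Matrix.of fun i j => if j = pairIdx i then gCoef q i else 0

lemma bijective_fe_fo (n : ℕ) : Function.Bijective (Sum.elim (fe n) (fo n)) := by
  refine ⟨?_, fun i => ?_⟩
  · rintro (k | k) (l | l) h <;> simp [fe, fo] at h <;>
      first | omega | exact congrArg _ (Fin.ext h)
  · rcases Nat.mod_two_eq_zero_or_one i.val with h | h
    · exact ⟨.inl ⟨i.val / 2, by omega⟩, Fin.ext (by simp [fe]; omega)⟩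
    · exact ⟨.inr ⟨i.val / 2, by omega⟩, Fin.ext (by simp [fo]; omega)⟩

lemma sum_fe_fo {M : Type*} [AddCommMonoid M] (f : Fin (2 * n) → M) :
    ∑ i, f i = ∑ k, f (fe n k) + ∑ k, f (fo n k) := by
  rw [← (bijective_fe_fo n).sum_comp, Fintype.sum_sum_type]
  rfl

@[simp]
lemma pairIdx_fe (k : Fin n) : pairIdx (fe n k) = fo n k := by
  ext; simp [pairIdx, fe, fo]

@[simp]
lemma pairIdx_fo (k : Fin n) : pairIdx (fo n k) = fe n k := by
  ext; simp [pairIdx, fe, fo]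

@[simp]
lemma gCoef_fe {R : Type*} [CommRing R] (q : R) (k : Fin n) : gCoef q (fe n k) = q := by
  simp [gCoef, fe]

@[simp]
lemma gCoef_fo {R : Type*} [CommRing R] (q : R) (k : Fin n) : gCoef q (fo n k) = -1 := by
  simp [gCoef, fo]

/-- The matrix `T G T̄ᵗ`. -/
def spMat (q : F) (T Tb : Matrix (Fin (2 * n)) (Fin (2 * n)) A) :
    Matrix (Fin (2 * n)) (Fin (2 * n)) A :=
  T * liftF F (gMat q n) * Tb.transpose

lemma spMat_apply (T Tb : Matrix (Fin (2 * n)) (Fin (2 * n)) A) (i j : Fin (2 * n)) :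
    spMat q T Tb i j = ∑ a, gCoef q a • (T i a * Tb j (pairIdx a)) := by
  simp only [spMat, Matrix.mul_apply, Finset.sum_mul, liftF, gMat, Matrix.map_apply,
    Matrix.of_apply, apply_ite (algebraMap F A), map_zero, mul_ite, mul_zero, ite_mul, zero_mul,
    Matrix.transpose_apply]
  rw [Finset.sum_comm]
  simp [← Algebra.commutes, mul_assoc, Algebra.smul_def]

lemma spMat_apply' (T Tb : Matrix (Fin (2 * n)) (Fin (2 * n)) A) (i j : Fin (2 * n)) :
    spMat q T Tb i j = q • ∑ k, T i (fe n k) * Tb j (fo n k)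
      - ∑ k, T i (fo n k) * Tb j (fe n k) := by
  simp [spMat_apply, sum_fe_fo, Finset.smul_sum, sub_eq_add_neg]

lemma spMat_gen (i j : Fin (2 * n)) :
    spMat q (Matrix.of (tE F q (2 * n))) (Matrix.of (tbE F q (2 * n))) i j = sSp F q n i j := by
  simp [spMat_apply', sSp, Algebra.smul_def]

@[simp]
lemma pairIdx_pairIdx (i : Fin (2 * n)) : pairIdx (pairIdx i) = i := by
  obtain ⟨k | k, rfl⟩ := (bijective_fe_fo n).2 i <;> simp

lemma eq_pairIdx_comm {i j : Fin (2 * n)} : i = pairIdx j ↔ j = pairIdx i := by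
  constructor <;> rintro rfl <;> simp

lemma pairIdx_ne (i : Fin (2 * n)) : pairIdx i ≠ i := by
  simp only [ne_eq, Fin.ext_iff, pairIdx]
  split_ifs <;> omega

@[simp] lemma fe_lt_fe {k l : Fin n} : fe n k < fe n l ↔ k < l := by simp [fe]

@[simp] lemma fo_lt_fo {k l : Fin n} : fo n k < fo n l ↔ k < l := by simp [fo]

@[simp] lemma fe_lt_fo {k l : Fin n} : fe n k < fo n l ↔ k ≤ l := by
  simp only [fe, fo, Fin.lt_def, Fin.le_def]; omega

@[simp] lemma fo_lt_fe {k l : Fin n} : fo n k < fe n l ↔ k < l := by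
  simp only [fe, fo, Fin.lt_def]; omega

@[simp] lemma fe_inj {k l : Fin n} : fe n k = fe n l ↔ k = l := by simp [fe, Fin.ext_iff]

@[simp] lemma fo_inj {k l : Fin n} : fo n k = fo n l ↔ k = l := by simp [fo, Fin.ext_iff]

@[simp] lemma fe_ne_fo {k l : Fin n} : fe n k ≠ fo n l := by
  simp only [fe, fo, ne_eq, Fin.ext_iff]; omega

@[simp] lemma fo_ne_fe {k l : Fin n} : fo n k ≠ fe n l := fe_ne_fo.symm

lemma reflection_gMat (hq : q ≠ 0) :
    reflLHS F q (gMat q n) = reflRHS F q (gMat q n) := by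
  ext ⟨i, j⟩ ⟨a, b⟩
  rw [reflLHS_apply, reflRHS_apply]
  simp only [gMat, Matrix.of_apply, smul_eq_mul]
  by_cases hj : j = pairIdx i
  · subst hj
    by_cases hb : b = pairIdx a
    · subst hb
      obtain ⟨i | i, rfl⟩ := (bijective_fe_fo n).2 i <;>
      obtain ⟨a | a, rfl⟩ := (bijective_fe_fo n).2 a <;>
      rcases lt_trichotomy i a with h | rfl | h <;>
      simp [Rdiag, Roff, *, le_of_lt, ne_of_lt, ne_of_gt, not_lt_of_gt] <;>
      field_simp <;> ring
    · have hb' : ¬ a = pairIdx b := fun h => hb (eq_pairIdx_comm.1 h)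
      by_cases ha : a = pairIdx i
      · subst ha
        simp_all [pairIdx_ne]
      · by_cases ha' : a = i <;> simp_all
  · have hj' : ¬ i = pairIdx j := fun h => hj (eq_pairIdx_comm.1 h)
    by_cases hij : i = j
    · subst hij
      by_cases ha : a = pairIdx i <;> by_cases hb : b = pairIdx i <;>
        simp_all [Roff, Rdiag, pairIdx_ne]
    · have hpij : pairIdx i ≠ pairIdx j := fun h => hij (by simpa using congrArg pairIdx h)
      have hoff : Roff q (pairIdx i) (pairIdx j) = Roff q i j := by
        obtain ⟨i | i, rfl⟩ := (bijective_fe_fo n).2 i <;>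
        obtain ⟨j | j, rfl⟩ := (bijective_fe_fo n).2 j <;>
        simp_all [Roff, le_iff_lt_or_eq, eq_comm]
      by_cases ha : a = pairIdx i
      · subst ha
        by_cases hb : b = pairIdx j
        · subst hb
          simp [hj, hj', Rdiag, hij, hpij, Ne.symm hj, Ne.symm hj', mul_comm]
        · by_cases hb' : b = pairIdx i <;> simp_all
      · by_cases ha' : a = pairIdx j
        · subst ha'
          by_cases hb : b = pairIdx i
          · subst hb
            simp_all [Rdiag, eq_comm, mul_comm]
          · by_cases hb' : b = pairIdx j <;> simp_all
        · simp_all [eq_comm]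

section Triangular

variable {T Tb : Matrix (Fin (2 * n)) (Fin (2 * n)) A} (h : IsGlPair q T Tb)

include h

lemma IsGlPair.spMat_tri (i j : Fin (2 * n)) (hij : i < j)
    (hij' : ¬(i.val % 2 = 0 ∧ j.val = i.val + 1)) : spMat q T Tb i j = 0 := by
  rw [spMat_apply]
  refine Finset.sum_eq_zero fun a _ => ?_
  by_cases h1 : i < a
  · simp [h.t_zero _ _ h1]
  · rw [h.tb_zero j (pairIdx a), mul_zero, smul_zero]
    simp only [pairIdx, Fin.lt_def] at *
    grind

lemma IsGlPair.spMat_fe_fe (k : Fin n) :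
    spMat q T Tb (fe n k) (fe n k) = q • (T (fe n k) (fe n k) * Tb (fe n k) (fo n k)) := by
  rw [spMat_apply, Finset.sum_eq_single (fe n k)]
  · simp
  · intro a _ ha
    by_cases h1 : fe n k < a
    · simp [h.t_zero _ _ h1]
    · rw [h.tb_zero _ (pairIdx a), mul_zero, smul_zero]
      simp only [pairIdx, Fin.lt_def, fe] at *
      grind
  · simp

lemma IsGlPair.spMat_fo_fo (k : Fin n) :
    spMat q T Tb (fo n k) (fo n k) = q • (T (fo n k) (fe n k) * Tb (fo n k) (fo n k)) := by
  rw [spMat_apply, Finset.sum_eq_single (fe n k)]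
  · simp
  · intro a _ ha
    by_cases h1 : fo n k < a
    · simp [h.t_zero _ _ h1]
    · rw [h.tb_zero _ (pairIdx a), mul_zero, smul_zero]
      simp only [pairIdx, Fin.lt_def, fe, fo] at *
      grind
  · simp

lemma IsGlPair.spMat_fe_fo (k : Fin n) :
    spMat q T Tb (fe n k) (fo n k) = q • (T (fe n k) (fe n k) * Tb (fo n k) (fo n k)) := by
  rw [spMat_apply, Finset.sum_eq_single (fe n k)]
  · simp
  · intro a _ ha
    by_cases h1 : fe n k < a
    · simp [h.t_zero _ _ h1]
    · rw [h.tb_zero _ (pairIdx a), mul_zero, smul_zero]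
      simp only [pairIdx, Fin.lt_def, fe, fo] at *
      grind
  · simp

lemma IsGlPair.spMat_fo_fe (k : Fin n) :
    spMat q T Tb (fo n k) (fe n k) = q • (T (fo n k) (fe n k) * Tb (fe n k) (fo n k))
      - T (fo n k) (fo n k) * Tb (fe n k) (fe n k) := by
  rw [spMat_apply, Finset.sum_eq_add (fe n k) (fo n k)]
  · simp [sub_eq_add_neg]
  · simp [fe, fo]
  · intro a _ ha
    by_cases h1 : fo n k < a
    · simp [h.t_zero _ _ h1]
    · rw [h.tb_zero _ (pairIdx a), mul_zero, smul_zero]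
      simp only [pairIdx, Fin.lt_def, fe, fo] at *
      grind
  · simp
  · simp

lemma IsGlPair.diag_comm (i j : Fin (2 * n)) : Commute (Tb i i) (T j j) := by
  have := congr_fun₂ h.rtbt (i, j) (i, j)
  rw [rttLHS_apply, rttRHS_apply] at this
  rcases lt_trichotomy i j with hij | rfl | hij
  · simpa [Rdiag, Roff, hij.ne, hij, h.t_zero _ _ hij, hij.not_gt] using! this
  · exact (h.tb_t i).trans (h.t_tb i).symm
  · simpa [Rdiag, Roff, hij.ne', hij, h.t_zero _ _ hij, hij.not_gt, h.tb_zero _ _ hij] using! this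

lemma IsGlPair.spMat_quad (hq : q ≠ 0) (k : Fin n) :
    spMat q T Tb (fo n k) (fo n k) * spMat q T Tb (fe n k) (fe n k)
      = algebraMap F A (q ^ 2) * (spMat q T Tb (fo n k) (fe n k) * spMat q T Tb (fe n k) (fo n k))
      + algebraMap F A (q ^ 3) := by
  rw [h.spMat_fe_fe, h.spMat_fe_fo, h.spMat_fo_fe, h.spMat_fo_fo]
  set e := fe n k
  set o := fo n k
  have heo : e < o := by simp [e, o, fe, fo]
  have h1 : T e e * Tb e o = q • (Tb e o * T e e) := by
    have := congr_fun₂ h.rtbt (e, e) (o, e)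
    simpa [rttLHS_apply, rttRHS_apply, Rdiag, Roff, heo, heo.ne', h.t_zero _ _ heo] using this.symm
  have h2 : Tb o o * Tb e o = q • (Tb e o * Tb o o) := by
    have := congr_fun₂ h.rtbtb (e, o) (o, o)
    simp [rttLHS_apply, rttRHS_apply, Rdiag, Roff, heo, heo.ne, sub_smul] at this
    have h5 : Tb e o * Tb o o = q⁻¹ • (Tb o o * Tb e o) := by
      rw [← sub_eq_zero] at this ⊢
      rw [← this]
      abel
    rw [h5, smul_smul, mul_inv_cancel₀ hq, one_smul]
  have h3 := (h.diag_comm o e).eq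
  have h4 : T o o * Tb e e * (T e e * Tb o o) = 1 := by
    rw [← mul_assoc, mul_assoc (T o o), h.tb_t, mul_one, h.t_tb]
  have h6 : T o e * Tb o o * (T e e * Tb e o) = q ^ 2 • (T o e * Tb e o * (T e e * Tb o o)) := by
    calc _ = T o e * Tb o o * (q • (Tb e o * T e e)) := by rw [h1]
      _ = q • (T o e * (Tb o o * Tb e o) * T e e) := by
        simp only [mul_smul_comm, mul_assoc]
      _ = q ^ 2 • (T o e * Tb e o * (Tb o o * T e e)) := by
        simp only [h2, mul_smul_comm, smul_mul_assoc, smul_smul, mul_assoc, pow_two]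
      _ = _ := by rw [h3]
  simp only [smul_mul_assoc, mul_smul_comm, h6, sub_mul, h4, smul_sub,
    smul_smul, Algebra.algebraMap_eq_smul_one, one_mul]
  rw [show q * (q * q ^ 2) = q ^ 2 * (q * q) by ring, show q ^ 2 * q = q ^ 3 by ring]
  abel

lemma IsGlPair.isSpPair (hq : q ≠ 0) {u : Fin n → A}
    (hu : ∀ k, spMat q T Tb (fe n k) (fo n k) * u k = 1 ∧
      u k * spMat q T Tb (fe n k) (fo n k) = 1) :
    IsSpPair q (spMat q T Tb) u :=
  ⟨h.spMat_tri, h.spMat_quad hq, fun k => (hu k).1, fun k => (hu k).2,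
    reflection_of_rtt h.rtt h.rtbtb h.rtbt (reflection_gMat hq)⟩

end Triangular

end Pairs

section OrderedSpan

variable {F : Type*} [Field F] {B : Type*} [Ring B] [Algebra F B] {ι : Type*}

/-- The span of the monomials in the `g i` whose factors are ordered as in the list `l`. -/
def orderedSpan (F : Type*) [Field F] {B : Type*} [Ring B] [Algebra F B] {ι : Type*} (g : ι → B)
    (l : List ι) : Submodule F B :=
  (l.map fun i => (Algebra.adjoin F {g i}).toSubmodule).prod

@[simp]
lemma orderedSpan_nil (g : ι → B) : orderedSpan F g [] = 1 := rfl

@[simp]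
lemma orderedSpan_cons (g : ι → B) (i : ι) (l : List ι) :
    orderedSpan F g (i :: l) = (Algebra.adjoin F {g i}).toSubmodule * orderedSpan F g l := rfl

lemma orderedSpan_append (g : ι → B) (l l' : List ι) :
    orderedSpan F g (l ++ l') = orderedSpan F g l * orderedSpan F g l' := by
  simp [orderedSpan]

lemma exists_perm_mem_orderedSpan (g : ι → B) (l w : List ι) (h : ∀ i ∈ w, i ∈ l) :
    ∃ w', w.Perm w' ∧ (w'.map g).prod ∈ orderedSpan F g l := by
  classical
  induction l generalizing w with
  | nil =>
    obtain rfl : w = [] := List.eq_nil_iff_forall_not_mem.2 fun i hi => by simpa using h i hi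
    exact ⟨[], .refl _, by simpa using ⟨1, map_one _⟩⟩
  | cons i l ih =>
    obtain ⟨w', hw', hm⟩ := ih (w.filter fun j => ¬ j = i) (by
      intro j hj
      simp only [List.mem_filter, decide_eq_true_eq] at hj
      exact (List.mem_cons.1 (h j hj.1)).resolve_left hj.2)
    refine ⟨w.filter (fun j => j = i) ++ w', ?_, ?_⟩
    · refine .trans ?_ (hw'.append_left _)
      simpa using (List.filter_append_perm (fun j => decide (j = i)) w).symm
    · rw [List.map_append, List.prod_append, orderedSpan_cons]
      refine Submodule.mul_mem_mul ?_ hm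
      have : (w.filter (fun j => j = i)).map g
          = List.replicate (w.filter (fun j => j = i)).length (g i) := by
        refine List.eq_replicate_iff.2 ⟨by simp, fun x hx => ?_⟩
        obtain ⟨j, hj, rfl⟩ := List.mem_map.1 hx
        simp only [List.mem_filter, decide_eq_true_eq] at hj
        rw [hj.2]
      rw [this, List.prod_replicate]
      exact pow_mem (Algebra.self_mem_adjoin_singleton F (g i)) _

variable {R : Type*} [CommRing R] [Algebra R B]

/-- The span of the words of length `d` in the `g i`. -/
def wordSpan (R : Type*) [CommRing R] {B : Type*} [Ring B] [Algebra R B] {ι : Type*} (g : ι → B)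
    (d : ℕ) : Submodule R B :=
  Submodule.span R ((fun w : List ι => (w.map g).prod) '' {w | w.length = d})

lemma mul_mem_smul_wordSpan (g : ι → B) (I : Ideal R) (w w' : List ι) {d d' : ℕ} {x : B}
    (hx : x ∈ I • wordSpan R g d) (hd : w.length + d + w'.length = d') :
    (w.map g).prod * x * (w'.map g).prod ∈ I • wordSpan R g d' := by
  let f : B →ₗ[R] B := LinearMap.mulRight R (w'.map g).prod ∘ₗ LinearMap.mulLeft R (w.map g).prod
  have : f x ∈ (I • wordSpan R g d).map f := Submodule.mem_map_of_mem hx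
  rw [Submodule.map_smul''] at this
  refine Submodule.smul_mono le_rfl ?_ this
  rw [wordSpan, Submodule.map_span_le]
  rintro _ ⟨v, hv, rfl⟩
  refine Submodule.subset_span ⟨w ++ v ++ w', ?_, by simp [f, mul_assoc]⟩
  simp only [Set.mem_ofPred_eq, List.length_append] at hv ⊢
  omega

variable [IsLocalRing R]

lemma perm_prod_sub_mem (g : ι → B)
    (hg : ∀ i j, g i * g j - g j * g i ∈ IsLocalRing.maximalIdeal R • wordSpan R g 2)
    {w w' : List ι} (h : w.Perm w') : (w.map g).prod - (w'.map g).prod ∈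
      IsLocalRing.maximalIdeal R • wordSpan R g w.length := by
  induction h with
  | nil => simp
  | cons i h ih =>
    simpa [mul_sub] using mul_mem_smul_wordSpan g _ [i] [] ih (by simp; omega)
  | swap i j w =>
    simpa [sub_mul, mul_assoc] using mul_mem_smul_wordSpan g _ [] w (hg j i) (by simp; omega)
  | trans h₁ h₂ ih₁ ih₂ =>
    rw [← h₁.length_eq] at ih₂
    simpa using add_mem ih₁ ih₂

/-- If the `g i` commute modulo the maximal ideal of a local ring of scalars, then the algebra
they generate is spanned by ordered monomials. -/
theorem adjoin_le_orderedSpan [Finite ι] [Algebra R F] [IsScalarTower R F B] (g : ι → B)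
    (hg : ∀ i j, g i * g j - g j * g i ∈ IsLocalRing.maximalIdeal R • wordSpan R g 2)
    (l : List ι) (hl : ∀ i, i ∈ l ∨ g i = 0) :
    (Algebra.adjoin F (Set.range g)).toSubmodule ≤ orderedSpan F g l := by
  have key (d : ℕ) : wordSpan R g d ≤ (orderedSpan F g l).restrictScalars R := by
    refine Submodule.le_of_le_smul_of_le_jacobson_bot (I := IsLocalRing.maximalIdeal R)
      (Submodule.fg_span ((List.finite_length_eq ι d).image _))
      (IsLocalRing.maximalIdeal_le_jacobson _) ?_
    rw [wordSpan, Submodule.span_le]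
    rintro _ ⟨w, hw, rfl⟩
    by_cases h : ∀ i ∈ w, i ∈ l
    · obtain ⟨w', hp, hm⟩ := exists_perm_mem_orderedSpan (F := F) g l w h
      have := perm_prod_sub_mem g hg hp
      rw [show w.length = d from hw] at this
      exact Submodule.mem_sup.2 ⟨_, hm, _, this, by simp⟩
    · push Not at h
      obtain ⟨i, hi, hil⟩ := h
      have : (w.map g).prod = 0 :=
        List.prod_eq_zero (List.mem_map.2 ⟨i, hi, (hl i).resolve_left hil⟩)
      simp [this]
  rw [Algebra.adjoin_eq_span, Submodule.span_le]
  intro x hx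
  obtain ⟨v, hv, rfl⟩ := Submonoid.exists_list_of_mem_closure hx
  obtain ⟨w, rfl⟩ : ∃ w : List ι, w.map g = v := by
    have : v ∈ Set.range (List.map g) := by rw [Set.range_list_map]; exact hv
    exact this
  exact key w.length (Submodule.subset_span ⟨w, rfl, rfl⟩)

end OrderedSpan

section Relations

variable {F : Type} [Field F] {q : F} {n : ℕ} {A : Type} [Ring A] [Algebra F A]
  {S : Matrix (Fin (2 * n)) (Fin (2 * n)) A} {u : Fin n → A}

lemma IsSpPair.commutator_mem {R : Type*} [CommRing R] [IsLocalRing R] [Algebra R F] [Algebra R A]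
    [IsScalarTower R F A] (h : IsSpPair q S u) (qR : Rˣ) (hqR : algebraMap R F qR = q)
    (hq1 : (qR : R) - 1 ∈ IsLocalRing.maximalIdeal R) (x y : Fin (2 * n) × Fin (2 * n)) :
    S x.1 x.2 * S y.1 y.2 - S y.1 y.2 * S x.1 x.2 ∈ IsLocalRing.maximalIdeal R •
      wordSpan R (fun p : Fin (2 * n) × Fin (2 * n) => S p.1 p.2) 2 := by
  obtain ⟨i, a⟩ := x
  obtain ⟨j, b⟩ := y
  have hW (i j k l) : S i j * S k l ∈
      wordSpan R (fun p : Fin (2 * n) × Fin (2 * n) => S p.1 p.2) 2 :=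
    Submodule.subset_span ⟨[(i, j), (k, l)], rfl, by simp⟩
  set W := wordSpan R (fun p : Fin (2 * n) × Fin (2 * n) => S p.1 p.2) 2
  set m := IsLocalRing.maximalIdeal R
  have hq0 : q ≠ 0 := by rw [← hqR]; exact (qR.isUnit.map (algebraMap R F)).ne_zero
  have hqi : algebraMap R F (qR⁻¹ : Rˣ) = q⁻¹ := by
    rw [eq_comm, inv_eq_iff_eq_inv, eq_comm, inv_eq_of_mul_eq_one_left]
    rw [← hqR, ← map_mul, Units.mul_inv, map_one]
  have hd (i j : Fin (2 * n)) : ∃ r : R, r ∈ m ∧ Rdiag q i j = algebraMap R F (1 + r) := by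
    by_cases hij : i = j
    · exact ⟨_, hq1, by simp [Rdiag, hij, hqR]⟩
    · exact ⟨0, zero_mem _, by simp [Rdiag, hij]⟩
  have ho (i j : Fin (2 * n)) : ∃ r : R, r ∈ m ∧ Roff q i j = algebraMap R F r := by
    by_cases hij : i < j
    · refine ⟨(qR : R) - (qR⁻¹ : Rˣ), ?_, by simp [Roff, hij, hqR, hqi]⟩
      have : (qR : R) - (qR⁻¹ : Rˣ) = ((qR : R) - 1) * (1 + (qR⁻¹ : Rˣ)) := by
        rw [sub_mul, mul_add, Units.mul_inv]; ring
      rw [this]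
      exact Ideal.mul_mem_right _ _ hq1
    · exact ⟨0, zero_mem _, by simp [Roff, hij]⟩
  have hrel := congr_fun₂ h.refl (i, j) (a, b)
  rw [reflLHS_apply, reflRHS_apply] at hrel
  obtain ⟨r1, h1, e1⟩ := hd i j
  obtain ⟨r2, h2, e2⟩ := hd a j
  obtain ⟨r3, h3, e3⟩ := hd a b
  obtain ⟨r4, h4, e4⟩ := hd i b
  obtain ⟨l1, k1, f1⟩ := ho a j
  obtain ⟨l2, k2, f2⟩ := ho i j
  obtain ⟨l3, k3, f3⟩ := ho b i
  obtain ⟨l4, k4, f4⟩ := ho b a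
  obtain ⟨d1, -, g1⟩ := hd a i
  obtain ⟨l5, k5, f5⟩ := ho a i
  obtain ⟨d2, -, g2⟩ := hd i a
  simp only [e1, e2, e3, e4, f1, f2, f3, f4, f5, g1, g2, algebraMap_smul] at hrel
  have key : S i a * S j b - S j b * S i a =
      -((r1 + r2 + r1 * r2) • (S i a * S j b)) - ((1 + r1) * l1) • (S i j * S a b)
      - l2 • ((1 + d1) • (S j a * S i b) + l5 • (S j i * S a b))
      + (r3 + r4 + r3 * r4) • (S j b * S i a) + ((1 + r3) * l3) • (S j i * S b a)
      + l4 • ((1 + d2) • (S j a * S i b) + l5 • (S j i * S a b)) := by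
    rw [← sub_eq_zero] at hrel ⊢
    rw [← hrel]
    module
  rw [key]
  have hs {r : R} {w : A} (hr : r ∈ m) (hw : w ∈ W) : r • w ∈ m • W :=
    Submodule.smul_mem_smul hr hw
  refine add_mem (add_mem (add_mem (sub_mem (sub_mem (neg_mem ?_) ?_) ?_) ?_) ?_) ?_
  · exact hs (add_mem (add_mem h1 h2) (Ideal.mul_mem_left _ _ h2)) (hW _ _ _ _)
  · exact hs (Ideal.mul_mem_left _ _ k1) (hW _ _ _ _)
  · exact hs k2 (add_mem (Submodule.smul_mem _ _ (hW _ _ _ _))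
      (Submodule.smul_mem _ _ (hW _ _ _ _)))
  · exact hs (add_mem (add_mem h3 h4) (Ideal.mul_mem_left _ _ h4)) (hW _ _ _ _)
  · exact hs (Ideal.mul_mem_left _ _ k3) (hW _ _ _ _)
  · exact hs k4 (add_mem (Submodule.smul_mem _ _ (hW _ _ _ _))
      (Submodule.smul_mem _ _ (hW _ _ _ _)))

lemma IsSpPair.apply_eq_zero (h : IsSpPair q S u) {k : Fin n} {j : Fin (2 * n)} (hj : fe n k < j)
    (hj' : j ≠ fo n k) : S (fe n k) j = 0 := by
  refine h.tri _ _ hj fun H => hj' ?_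
  ext
  simpa [fe, fo] using H.2

lemma IsSpPair.apply_eq_zero' (h : IsSpPair q S u) {k : Fin n} {j : Fin (2 * n)} (hj : j < fo n k)
    (hj' : j ≠ fe n k) : S j (fo n k) = 0 := by
  refine h.tri _ _ hj fun H => hj' ?_
  ext
  have := H.2
  simp only [fe, fo] at this ⊢
  omega

lemma lt_fo_iff {k : Fin n} {j : Fin (2 * n)} : j < fo n k ↔ j ≤ fe n k := by
  simp only [fe, fo, Fin.lt_def, Fin.le_def]; omega

lemma fe_lt_iff {k : Fin n} {j : Fin (2 * n)} : fe n k < j ↔ fo n k ≤ j := by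
  simp only [fe, fo, Fin.lt_def, Fin.le_def]; omega

/-- The elements `s_{ii'}`, `i` odd, commute with all generators up to powers of `q`. -/
lemma IsSpPair.diag_qcomm (h : IsSpPair q S u) (hq : q ≠ 0) (k : Fin n) (j b : Fin (2 * n)) :
    ∃ e : ℤ, S (fe n k) (fo n k) * S j b = q ^ e • (S j b * S (fe n k) (fo n k)) := by
  have hrel := congr_fun₂ h.refl (fe n k, j) (fo n k, b)
  rw [reflLHS_apply, reflRHS_apply] at hrel
  have e1 : Roff q (fo n k) j • (S (fe n k) j * S (fo n k) b) = 0 := by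
    by_cases hj : fo n k < j
    · rw [h.apply_eq_zero (fe_lt_iff.2 hj.le) hj.ne', zero_mul, smul_zero]
    · simp [Roff, hj]
  have e2 : Roff q b (fe n k) • (S j (fe n k) * S b (fo n k)) = 0 := by
    by_cases hb : b < fe n k
    · rw [h.apply_eq_zero' (lt_fo_iff.2 hb.le) hb.ne, mul_zero, smul_zero]
    · simp [Roff, hb]
  have e3 : Roff q (fo n k) (fe n k) = 0 := by simp [Roff]
  have e4 : Rdiag q (fo n k) (fe n k) = 1 := by simp [Rdiag]
  have e5 : Rdiag q (fe n k) (fo n k) = 1 := by simp [Rdiag]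
  rw [e1, e2, e3, e4, e5] at hrel
  have hd (i j : Fin (2 * n)) : ∃ e : ℤ, Rdiag q i j = q ^ e := by
    by_cases hij : i = j
    · exact ⟨1, by simp [Rdiag, hij]⟩
    · exact ⟨0, by simp [Rdiag, hij]⟩
  have fin {l r : F} {x y : A} (hl : ∃ e : ℤ, l = q ^ e) (hr : ∃ e : ℤ, r = q ^ e)
      (hxy : l • x = r • y) : ∃ e : ℤ, x = q ^ e • y := by
    obtain ⟨e, rfl⟩ := hl
    obtain ⟨e', rfl⟩ := hr
    refine ⟨-e + e', ?_⟩
    rw [zpow_add₀ hq, mul_smul, ← hxy, smul_smul, zpow_neg, inv_mul_cancel₀ (zpow_ne_zero _ hq),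
      one_smul]
  have hdd (i j a b : Fin (2 * n)) : ∃ e : ℤ, Rdiag q i j * Rdiag q a b = q ^ e := by
    obtain ⟨e, he⟩ := hd i j
    obtain ⟨e', he'⟩ := hd a b
    exact ⟨e + e', by rw [he, he', zpow_add₀ hq]⟩
  simp only [add_zero, zero_smul, one_smul, smul_smul] at hrel
  have hzero (h0 : S j (fo n k) * S (fe n k) b = 0) :
      ∃ e : ℤ, S (fe n k) (fo n k) * S j b = q ^ e • (S j b * S (fe n k) (fo n k)) := by
    rw [h0, smul_zero, smul_zero, add_zero, add_zero] at hrel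
    exact fin (hdd ..) (hdd ..) hrel
  rcases lt_or_ge (fe n k) b with hb | hb
  · by_cases hb' : b = fo n k
    · subst hb'
      rcases lt_trichotomy j (fe n k) with hj | rfl | hj
      · exact hzero (by rw [h.apply_eq_zero' (lt_fo_iff.2 hj.le) hj.ne, zero_mul])
      · exact ⟨0, by simp⟩
      · refine fin (hd (fo n k) j) (r := q⁻¹) ⟨-1, by simp⟩ ?_
        simp only [Rdiag, Roff, hj, hj.ne, if_true, if_false, lt_irrefl, fe_ne_fo, one_mul,
          zero_smul, add_zero, mul_one, sub_smul] at hrel ⊢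
        rw [← sub_eq_zero] at hrel ⊢
        rw [← hrel]
        abel
    · exact hzero (by rw [h.apply_eq_zero hb hb', mul_zero])
  · have hb' : b < fo n k := lt_fo_iff.2 hb
    rcases lt_trichotomy j (fe n k) with hj | rfl | hj
    · exact hzero (by rw [h.apply_eq_zero' (lt_fo_iff.2 hj.le) hj.ne, zero_mul])
    · refine fin (l := q⁻¹) ⟨-1, by simp⟩ (hdd (fo n k) b (fe n k) b) ?_
      simp only [Rdiag, Roff, hb', if_true, if_false, lt_irrefl, fo_ne_fe,
          zero_smul, add_zero, mul_one, sub_smul] at hrel ⊢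
      rw [← sub_eq_zero] at hrel ⊢
      rw [← hrel]
      abel
    · simp only [Roff, hj, hb', if_true, add_left_inj] at hrel
      exact fin (hdd ..) (hdd ..) hrel

lemma IsSpPair.diag_comm (h : IsSpPair q S u) (k l : Fin n) :
    Commute (S (fe n k) (fo n k)) (S (fe n l) (fo n l)) := by
  rcases eq_or_ne k l with rfl | hkl
  · exact .refl _
  have hrel := congr_fun₂ h.refl (fe n k, fe n l) (fo n k, fo n l)
  rw [reflLHS_apply, reflRHS_apply] at hrel
  rcases lt_or_gt_of_ne hkl with hk | hk
  · have h1 : S (fe n k) (fe n l) = 0 := h.apply_eq_zero (by simpa) (by simp)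
    have h2 : S (fe n k) (fo n l) = 0 := h.apply_eq_zero (by simpa using hk.le) (by simp [hkl.symm])
    simpa [Rdiag, Roff, hk, hk.ne, hk.ne', hk.le, hk.not_ge, hk.not_gt, h1, h2] using! hrel
  · have h1 : S (fe n l) (fe n k) = 0 := h.apply_eq_zero (by simpa) (by simp)
    have h2 : S (fe n l) (fo n k) = 0 := h.apply_eq_zero (by simpa using hk.le) (by simp [hkl])
    simpa [Rdiag, Roff, hk, hk.ne, hk.ne', hk.le, hk.not_ge, hk.not_gt, h1, h2] using! hrel

lemma IsSpPair.lower_eq (h : IsSpPair q S u) (hq : q ≠ 0) (k : Fin n) :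
    S (fo n k) (fe n k)
      = ((q ^ 2)⁻¹ • (S (fo n k) (fo n k) * S (fe n k) (fe n k)) - q • 1) * u k := by
  rw [h.quad, sub_mul, smul_add, add_mul, ← Algebra.smul_def, smul_smul,
    inv_mul_cancel₀ (pow_ne_zero 2 hq), one_smul, mul_assoc, h.invR, mul_one,
    Algebra.algebraMap_eq_smul_one, smul_smul, show (q ^ 2)⁻¹ * q ^ 3 = q by field_simp]
  abel

lemma IsSpPair.fe_mul_fo (h : IsSpPair q S u) (hq : q ≠ 0) (k : Fin n) :
    S (fe n k) (fe n k) * S (fo n k) (fo n k)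
      = (q ^ 2)⁻¹ • (S (fo n k) (fo n k) * S (fe n k) (fe n k)) + (q ^ 3 - q) • 1
        - (q - q⁻¹) • S (fe n k) (fo n k) ^ 2 := by
  have hrel := congr_fun₂ h.refl (fe n k, fo n k) (fe n k, fo n k)
  rw [reflLHS_apply, reflRHS_apply] at hrel
  have hy : S (fo n k) (fe n k) * S (fe n k) (fo n k)
      = (q ^ 2)⁻¹ • (S (fo n k) (fo n k) * S (fe n k) (fe n k)) - q • 1 := by
    rw [h.lower_eq hq, mul_assoc, h.invL, mul_one]
  simp only [Rdiag, Roff, hy, fe_ne_fo, fe_lt_fo, le_refl, if_true, if_false, one_smul, lt_irrefl,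
    zero_smul, add_zero, fo_lt_fe] at hrel
  rw [← sub_eq_zero] at hrel ⊢
  rw [← hrel]
  simp only [smul_sub, sub_smul, smul_smul, pow_two]
  match_scalars <;> field_simp
  ring

end Relations

section Calculus

variable {F : Type*} [Field F] {B : Type*} [Ring B] [Algebra F B] {C : Subalgebra F B}

lemma subalgebra_mul_mul_le {M N : Submodule F B} (hM : C.toSubmodule * M ≤ M * C.toSubmodule)
    (hN : C.toSubmodule * N ≤ N * C.toSubmodule) :
    C.toSubmodule * (M * N) ≤ M * N * C.toSubmodule := by
  calc _ = (C.toSubmodule * M) * N := (mul_assoc ..).symm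
    _ ≤ M * C.toSubmodule * N := by gcongr
    _ = M * (C.toSubmodule * N) := mul_assoc ..
    _ ≤ M * (N * C.toSubmodule) := by gcongr
    _ = _ := (mul_assoc ..).symm

lemma subalgebra_mul_adjoin_le {x : B} (hx : ∀ c ∈ C, ∃ c' ∈ C, c * x = x * c') :
    C.toSubmodule * (Algebra.adjoin F {x}).toSubmodule
      ≤ (Algebra.adjoin F {x}).toSubmodule * C.toSubmodule := by
  rw [Submodule.mul_le]
  intro c hc y hy
  rw [Subalgebra.mem_toSubmodule] at hy
  induction hy using Algebra.adjoin_induction generalizing c with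
  | mem y hy =>
    obtain rfl : y = x := hy
    obtain ⟨c', hc', h⟩ := hx c hc
    rw [h]
    exact Submodule.mul_mem_mul (Algebra.self_mem_adjoin_singleton F y) hc'
  | algebraMap r =>
    rw [← Algebra.commutes]
    exact Submodule.mul_mem_mul (algebraMap_mem (Algebra.adjoin F {x}) r) hc
  | add y z _ _ hy hz => rw [mul_add]; exact add_mem (hy c hc) (hz c hc)
  | mul y z hy' _ hy hz =>
    rw [← mul_assoc]
    refine Submodule.mul_induction_on (hy c hc) (fun m hm d hd => ?_) fun v w h1 h2 => ?_
    · rw [mul_assoc]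
      have h1 := Submodule.mul_mem_mul hm (hz d hd)
      rwa [← mul_assoc, (Algebra.adjoin F {x}).isIdempotentElem_toSubmodule.eq] at h1
    · rw [add_mul]
      exact add_mem h1 h2

lemma subalgebra_mul_orderedSpan_le {ι : Type*} (g : ι → B)
    (hg : ∀ i, ∀ c ∈ C, ∃ c' ∈ C, c * g i = g i * c') (l : List ι) :
    C.toSubmodule * orderedSpan F g l ≤ orderedSpan F g l * C.toSubmodule := by
  induction l with
  | nil => simp
  | cons i l ih => exact subalgebra_mul_mul_le (subalgebra_mul_adjoin_le (hg i)) ih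

end Calculus

/-- Index pairs `(i, j)` with `j` in an earlier `2 × 2` block than `i`. -/
def offPairs (n : ℕ) : List (Fin (2 * n) × Fin (2 * n)) :=
  (Finset.univ.filter fun p : Fin (2 * n) × Fin (2 * n) => p.2.val / 2 < p.1.val / 2).toList

/-- The diagonal index pairs, grouped by `2 × 2` blocks. -/
def diagPairs {n : ℕ} (ks : List (Fin n)) : List (Fin (2 * n) × Fin (2 * n)) :=
  ks.flatMap fun k => [(fo n k, fo n k), (fe n k, fe n k)]

/-- The index pairs in the lower triangles of the `2 × 2` blocks. -/
def lowPairs {n : ℕ} (ks : List (Fin n)) : List (Fin (2 * n) × Fin (2 * n)) :=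
  ks.flatMap fun k => [(fo n k, fo n k), (fo n k, fe n k), (fe n k, fe n k)]

/-- The index pairs `(i, i')` with `i` odd. -/
def upPairs (n : ℕ) : List (Fin (2 * n) × Fin (2 * n)) :=
  (List.finRange n).map fun k => (fe n k, fo n k)

section Spanning

variable {F : Type} [Field F] {q : F} {n : ℕ} {A : Type} [Ring A] [Algebra F A]
  {S : Matrix (Fin (2 * n)) (Fin (2 * n)) A} {u : Fin n → A}

/-- The subalgebra generated by the elements `s_{ii'}`, `i` odd, and their inverses. -/
def torus (F : Type) [Field F] {A : Type} [Ring A] [Algebra F A]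
    (S : Matrix (Fin (2 * n)) (Fin (2 * n)) A) (u : Fin n → A) : Subalgebra F A :=
  Algebra.adjoin F (Set.range (fun k => S (fe n k) (fo n k)) ∪ Set.range u)

/-- The entries of a matrix, indexed by pairs. -/
abbrev entry (S : Matrix (Fin (2 * n)) (Fin (2 * n)) A) (p : Fin (2 * n) × Fin (2 * n)) : A :=
  S p.1 p.2

/-- The product of the elements `s_{ii'}`, `i` odd. -/
def zProd (S : Matrix (Fin (2 * n)) (Fin (2 * n)) A) : A :=
  ((List.finRange n).map fun k => S (fe n k) (fo n k)).prod

lemma z_mem_torus (k : Fin n) : S (fe n k) (fo n k) ∈ torus F S u :=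
  Algebra.subset_adjoin (.inl ⟨k, rfl⟩)

lemma u_mem_torus (k : Fin n) : u k ∈ torus F S u :=
  Algebra.subset_adjoin (.inr ⟨k, rfl⟩)

lemma IsSpPair.isUnit_zProd (h : IsSpPair q S u) : IsUnit (zProd S) := by
  refine List.prod_isUnit fun x hx => ?_
  obtain ⟨k, -, rfl⟩ := List.mem_map.1 hx
  exact ⟨⟨_, u k, h.invR k, h.invL k⟩, rfl⟩

lemma IsSpPair.torus_comm (h : IsSpPair q S u) (hq : q ≠ 0) (p : Fin (2 * n) × Fin (2 * n)) :
    ∀ c ∈ torus F S u, ∃ c' ∈ torus F S u, c * entry S p = entry S p * c' := by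
  intro c hc
  induction hc using Algebra.adjoin_induction with
  | mem c hc =>
    rcases hc with ⟨k, rfl⟩ | ⟨k, rfl⟩ <;> obtain ⟨e, he⟩ := h.diag_qcomm hq k p.1 p.2
    · exact ⟨_, Subalgebra.smul_mem _ (z_mem_torus k) (q ^ e), by rw [he, mul_smul_comm]⟩
    · refine ⟨_, Subalgebra.smul_mem _ (u_mem_torus k) (q ^ (-e)), ?_⟩
      have h1 : S p.1 p.2 * u k = q ^ e • (u k * S p.1 p.2) := by
        calc _ = u k * (S (fe n k) (fo n k) * S p.1 p.2) * u k := by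
              rw [← mul_assoc, h.invL, one_mul]
          _ = _ := by
              rw [he, mul_smul_comm, smul_mul_assoc, mul_assoc, mul_assoc, h.invR, mul_one]
      rw [mul_smul_comm, h1, smul_smul, zpow_neg, inv_mul_cancel₀ (zpow_ne_zero _ hq), one_smul]
  | algebraMap r => exact ⟨_, algebraMap_mem _ r, Algebra.commutes ..⟩
  | add c d _ _ hc hd =>
    obtain ⟨c', h1, h2⟩ := hc
    obtain ⟨d', h3, h4⟩ := hd
    exact ⟨_, add_mem h1 h3, by rw [add_mul, mul_add, h2, h4]⟩
  | mul c d _ _ hc hd =>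
    obtain ⟨c', h1, h2⟩ := hc
    obtain ⟨d', h3, h4⟩ := hd
    exact ⟨_, mul_mem h1 h3, by rw [mul_assoc, h4, ← mul_assoc, h2, mul_assoc]⟩

lemma IsSpPair.torus_mul_orderedSpan (h : IsSpPair q S u) (hq : q ≠ 0)
    (l : List (Fin (2 * n) × Fin (2 * n))) :
    (torus F S u).toSubmodule * orderedSpan F (entry S) l
      ≤ orderedSpan F (entry S) l * (torus F S u).toSubmodule :=
  subalgebra_mul_orderedSpan_le _ (h.torus_comm hq) l

/-- The lower left entry of a `2 × 2` block is not needed to span. -/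
lemma IsSpPair.block_le (h : IsSpPair q S u) (hq : q ≠ 0) (k : Fin n) :
    orderedSpan F (entry S) [(fo n k, fo n k), (fo n k, fe n k), (fe n k, fe n k)]
      ≤ orderedSpan F (entry S) [(fo n k, fo n k), (fe n k, fe n k)]
        * (torus F S u).toSubmodule := by
  set C := torus F S u with hC
  set a := S (fe n k) (fe n k) with ha
  set b := S (fo n k) (fo n k) with hb
  set y := S (fo n k) (fe n k) with hy
  set Ha := (Algebra.adjoin F {a}).toSubmodule with hHa
  set Hb := (Algebra.adjoin F {b}).toSubmodule with hHb
  have hCa : C.toSubmodule * Ha ≤ Ha * C.toSubmodule :=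
    subalgebra_mul_adjoin_le (h.torus_comm hq (fe n k, fe n k))
  have hCb : C.toSubmodule * Hb ≤ Hb * C.toSubmodule :=
    subalgebra_mul_adjoin_le (h.torus_comm hq (fo n k, fo n k))
  have hCC : C.toSubmodule * C.toSubmodule = C.toSubmodule := C.isIdempotentElem_toSubmodule
  have hHaa : Ha * Ha = Ha := Subalgebra.isIdempotentElem_toSubmodule _
  have hHbb : Hb * Hb = Hb := Subalgebra.isIdempotentElem_toSubmodule _
  have hC1 : (1 : A) ∈ C.toSubmodule := one_mem C
  have ha1 : (1 : A) ∈ Ha := one_mem (Algebra.adjoin F {a})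
  have hb1 : (1 : A) ∈ Hb := one_mem (Algebra.adjoin F {b})
  have haHa : a ∈ Ha := Algebra.self_mem_adjoin_singleton F a
  have hbHb : b ∈ Hb := Algebra.self_mem_adjoin_singleton F b
  set H := Hb * Ha * C.toSubmodule with hH
  let St : Subalgebra F A :=
    { carrier := {x | ∀ w ∈ H, x * w ∈ H}
      mul_mem' := fun hx hy w hw => by rw [mul_assoc]; exact hx _ (hy _ hw)
      add_mem' := fun hx hy w hw => by rw [add_mul]; exact add_mem (hx _ hw) (hy _ hw)
      algebraMap_mem' := fun r w hw => by
        rw [← Algebra.smul_def]; exact Submodule.smul_mem _ _ hw }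
  have memSt {x : A} {M : Submodule F A} (hM : M * H ≤ H) (hx : x ∈ M) : x ∈ St :=
    fun w hw => hM (Submodule.mul_mem_mul hx hw)
  have hbSt : b ∈ St := memSt (M := Hb) (by rw [hH, ← mul_assoc, ← mul_assoc, hHbb]) hbHb
  have hCSt {c : A} (hc : c ∈ C) : c ∈ St := by
    refine memSt (M := C.toSubmodule) ?_ hc
    calc C.toSubmodule * H = C.toSubmodule * (Hb * Ha) * C.toSubmodule := (mul_assoc ..).symm
      _ ≤ Hb * Ha * C.toSubmodule * C.toSubmodule := by
        exact mul_le_mul_left (subalgebra_mul_mul_le hCb hCa) _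
      _ = H := by rw [mul_assoc, hCC]
  have hHaC : Ha * C.toSubmodule * Ha * C.toSubmodule ≤ Ha * C.toSubmodule := by
    calc _ = Ha * (C.toSubmodule * Ha) * C.toSubmodule := by simp only [mul_assoc]
      _ ≤ Ha * (Ha * C.toSubmodule) * C.toSubmodule := by gcongr
      _ = Ha * C.toSubmodule := by
        rw [← mul_assoc, hHaa, mul_assoc, hCC]
  have haH : ∀ f ∈ Algebra.adjoin F {b}, a * f ∈ H := by
    have hbH (m : ℕ) : b ^ m ∈ H := by
      have hm : b ^ m ∈ Hb := pow_mem (Algebra.self_mem_adjoin_singleton F b) m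
      simpa using Submodule.mul_mem_mul (Submodule.mul_mem_mul hm ha1) hC1
    have habH (m : ℕ) : a * b ^ m ∈ H := by
      induction m with
      | zero => simpa using Submodule.mul_mem_mul (Submodule.mul_mem_mul hb1 haHa) hC1
      | succ m ih =>
        rw [pow_succ', ← mul_assoc, h.fe_mul_fo hq, sub_mul, add_mul, smul_mul_assoc,
          smul_mul_assoc, smul_mul_assoc, one_mul, mul_assoc]
        exact sub_mem (add_mem (Submodule.smul_mem _ _ (hbSt _ ih))
          (Submodule.smul_mem _ _ (hbH m)))
          (Submodule.smul_mem _ _ (pow_mem (hCSt (z_mem_torus k)) 2 _ (hbH m)))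
    intro f hf
    rw [← Subalgebra.mem_toSubmodule, Algebra.adjoin_eq_span] at hf
    induction hf using Submodule.span_induction with
    | mem f hf =>
      obtain ⟨m, rfl⟩ := Submonoid.mem_closure_singleton.1 hf
      exact habH m
    | zero => simp
    | add f g _ _ hf hg => rw [mul_add]; exact add_mem hf hg
    | smul r f _ hf => rw [mul_smul_comm]; exact Submodule.smul_mem _ _ hf
  have haSt : a ∈ St := by
    refine memSt (M := Submodule.span F {a}) ?_ (Submodule.mem_span_singleton_self a)
    have : Submodule.span F {a} * Hb ≤ H := by
      rw [Submodule.mul_le]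
      intro x hx f hf
      obtain ⟨r, rfl⟩ := Submodule.mem_span_singleton.1 hx
      rw [smul_mul_assoc]
      exact Submodule.smul_mem _ _ (haH f hf)
    calc Submodule.span F {a} * H = Submodule.span F {a} * Hb * Ha * C.toSubmodule := by
          simp only [hH, mul_assoc]
      _ ≤ H * Ha * C.toSubmodule := by gcongr
      _ = Hb * (Ha * C.toSubmodule * Ha * C.toSubmodule) := by simp only [hH, mul_assoc]
      _ ≤ Hb * (Ha * C.toSubmodule) := by gcongr
      _ = H := by rw [hH, mul_assoc]
  have hySt : y ∈ St := by
    rw [hy, h.lower_eq hq]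
    exact mul_mem (sub_mem (Subalgebra.smul_mem _ (mul_mem hbSt haSt) _)
      (Subalgebra.smul_mem _ (one_mem _) _)) (hCSt (u_mem_torus k))
  have hle {x : A} (hx : x ∈ St) : (Algebra.adjoin F {x}).toSubmodule * H ≤ H := by
    rw [Submodule.mul_le]
    intro m hm w hw
    exact (Algebra.adjoin_le (Set.singleton_subset_iff.2 hx) : Algebra.adjoin F {x} ≤ St) hm w hw
  have h1H : (1 : Submodule F A) ≤ H := by
    calc (1 : Submodule F A) = 1 * 1 * 1 := by simp
      _ ≤ H := mul_le_mul' (mul_le_mul' (Submodule.one_le.2 hb1) (Submodule.one_le.2 ha1))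
        (Submodule.one_le.2 hC1)
  simp only [orderedSpan_cons, orderedSpan_nil, mul_one]
  calc _ ≤ Hb * ((Algebra.adjoin F {y}).toSubmodule * (Ha * H)) := by
        gcongr
        calc Ha = Ha * 1 := (mul_one _).symm
          _ ≤ Ha * H := by gcongr
    _ ≤ H := ((mul_le_mul_right ((mul_le_mul_right (hle haSt) _).trans (hle hySt)) _)).trans
      (hle hbSt)

lemma IsSpPair.lowPairs_le (h : IsSpPair q S u) (hq : q ≠ 0) (ks : List (Fin n)) :
    orderedSpan F (entry S) (lowPairs ks)
      ≤ orderedSpan F (entry S) (diagPairs ks) * (torus F S u).toSubmodule := by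
  induction ks with
  | nil => simp [lowPairs, diagPairs]
  | cons k ks ih =>
    have h1 : lowPairs (k :: ks)
      = [(fo n k, fo n k), (fo n k, fe n k), (fe n k, fe n k)] ++ lowPairs ks := rfl
    have h2 : diagPairs (k :: ks)
      = [(fo n k, fo n k), (fe n k, fe n k)] ++ diagPairs ks := rfl
    rw [h1, h2, orderedSpan_append, orderedSpan_append]
    set C := (torus F S u).toSubmodule
    set V := orderedSpan F (entry S) (diagPairs ks)
    set W := orderedSpan F (entry S) [(fo n k, fo n k), (fe n k, fe n k)]
    calc _ ≤ (W * C) * (V * C) := mul_le_mul' (h.block_le hq k) ih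
      _ = W * (C * V) * C := by simp only [mul_assoc]
      _ ≤ W * (V * C) * C :=
        mul_le_mul_left (mul_le_mul_right (h.torus_mul_orderedSpan hq _) _) _
      _ = W * V * C := by
        rw [mul_assoc, mul_assoc, (torus F S u).isIdempotentElem_toSubmodule.eq, mul_assoc]

lemma orderedSpan_upPairs_le : orderedSpan F (entry S) (upPairs n) ≤ (torus F S u).toSubmodule := by
  suffices ∀ ks : List (Fin n), orderedSpan F (entry S) (ks.map fun k => (fe n k, fo n k))
      ≤ (torus F S u).toSubmodule from this _
  intro ks
  induction ks with
  | nil => exact Submodule.one_le.2 (one_mem (torus F S u))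
  | cons k ks ih =>
    rw [List.map_cons, orderedSpan_cons, ← (torus F S u).isIdempotentElem_toSubmodule.eq]
    have hk : Algebra.adjoin F {entry S (fe n k, fo n k)} ≤ torus F S u :=
      Algebra.adjoin_le (Set.singleton_subset_iff.2 (z_mem_torus k))
    exact mul_le_mul' hk ih

lemma mem_pairs_or_eq_zero (h : IsSpPair q S u) (p : Fin (2 * n) × Fin (2 * n)) :
    p ∈ offPairs n ++ lowPairs (List.finRange n) ++ upPairs n ∨ entry S p = 0 := by
  obtain ⟨i, j⟩ := p
  have hmem (k : Fin n) (x) (hx : x = (fo n k, fo n k) ∨ x = (fo n k, fe n k) ∨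
      x = (fe n k, fe n k) ∨ x = (fe n k, fo n k)) :
      x ∈ offPairs n ++ lowPairs (List.finRange n) ++ upPairs n := by
    rcases hx with rfl | rfl | rfl | rfl <;> simp [lowPairs, upPairs]
  rcases lt_trichotomy (j.val / 2) (i.val / 2) with hij | hij | hij
  · exact .inl (by simp [offPairs, hij])
  · left
    obtain ⟨k | k, rfl⟩ := (bijective_fe_fo n).2 i <;>
    obtain ⟨l | l, rfl⟩ := (bijective_fe_fo n).2 j <;>
    obtain rfl : k = l := by
      ext
      simp only [fe, fo, Sum.elim_inl, Sum.elim_inr] at hij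
      omega
    all_goals exact hmem k _ (by simp)
  · exact .inr (h.tri i j (by rw [Fin.lt_def]; omega) (by omega))

variable {R : Type*} [CommRing R] [IsLocalRing R] [Algebra R F] [Algebra R A]
  [IsScalarTower R F A]

theorem IsSpPair.mem_mul_torus (h : IsSpPair q S u) (hq : q ≠ 0) (qR : Rˣ)
    (hqR : algebraMap R F qR = q) (hq1 : (qR : R) - 1 ∈ IsLocalRing.maximalIdeal R)
    (hgen : Algebra.adjoin F (Set.range (entry S) ∪ Set.range u) = ⊤) (f : A) :
    f ∈ orderedSpan F (entry S) (offPairs n ++ diagPairs (List.finRange n))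
      * (torus F S u).toSubmodule := by
  set C := (torus F S u).toSubmodule with hC
  have hCC : C * C = C := (torus F S u).isIdempotentElem_toSubmodule.eq
  set P := Algebra.adjoin F (Set.range (entry S)) with hP
  have h1 : P.toSubmodule ≤
      orderedSpan F (entry S) (offPairs n ++ diagPairs (List.finRange n)) * C := by
    refine (adjoin_le_orderedSpan (entry S) (h.commutator_mem qR hqR hq1) _
      (mem_pairs_or_eq_zero h)).trans ?_
    rw [orderedSpan_append, orderedSpan_append, orderedSpan_append]
    refine (mul_le_mul' (mul_le_mul_right (h.lowPairs_le hq _) _)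
      (orderedSpan_upPairs_le (u := u))).trans ?_
    rw [← mul_assoc, mul_assoc, hCC]
  suffices f ∈ P.toSubmodule * C by
    have := mul_le_mul_left h1 C this
    rwa [mul_assoc, hCC] at this
  let St : Subalgebra F A :=
    { carrier := {x | ∀ w ∈ P.toSubmodule * C, w * x ∈ P.toSubmodule * C}
      mul_mem' := fun hx hy w hw => by rw [← mul_assoc]; exact hy _ (hx _ hw)
      add_mem' := fun hx hy w hw => by rw [mul_add]; exact add_mem (hx _ hw) (hy _ hw)
      algebraMap_mem' := fun r w hw => by
        rw [← Algebra.commutes, ← Algebra.smul_def]; exact Submodule.smul_mem _ _ hw }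
  have hSt : St = ⊤ := by
    rw [eq_top_iff, ← hgen, Algebra.adjoin_le_iff]
    have hCSt {c : A} (hc : c ∈ C) : c ∈ St := fun w hw => by
      have := Submodule.mul_mem_mul hw hc
      rwa [mul_assoc, hCC] at this
    rintro _ (⟨p, rfl⟩ | ⟨k, rfl⟩)
    · intro w hw
      refine Submodule.mul_induction_on hw (fun m hm c hc => ?_) fun v w h1 h2 => ?_
      · obtain ⟨c', hc', hcc⟩ := h.torus_comm hq p c hc
        rw [mul_assoc, hcc, ← mul_assoc]
        exact Submodule.mul_mem_mul (mul_mem (s := P) hm (Algebra.subset_adjoin ⟨p, rfl⟩)) hc'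
      · rw [add_mul]
        exact add_mem h1 h2
    · exact hCSt (u_mem_torus k)
  have hf : f ∈ St := hSt ▸ Algebra.mem_top
  have h11 : (1 : A) ∈ P.toSubmodule * C := by
    have h1C : (1 : A) ∈ C := one_mem (torus F S u)
    simpa using Submodule.mul_mem_mul (one_mem P : (1 : A) ∈ P.toSubmodule) h1C
  simpa using hf 1 h11

lemma IsSpPair.adjoin_le_upPairs (h : IsSpPair q S u) :
    (Algebra.adjoin F (Set.range fun k => S (fe n k) (fo n k))).toSubmodule
      ≤ orderedSpan F (entry S) (upPairs n) := by
  have := adjoin_le_orderedSpan (R := F) (F := F) (fun k => S (fe n k) (fo n k))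
    (fun k l => by rw [(h.diag_comm k l).eq, sub_self]; exact zero_mem _)
    (List.finRange n) (fun k => .inl (List.mem_finRange k))
  refine this.trans (le_of_eq ?_)
  rw [upPairs, orderedSpan, orderedSpan, List.map_map]
  rfl

lemma IsSpPair.commute_zProd (h : IsSpPair q S u) {c : A} (hc : c ∈ torus F S u) :
    Commute c (zProd S) := by
  induction hc using Algebra.adjoin_induction with
  | mem c hc =>
    refine Commute.list_prod_right _ _ fun x hx => ?_
    obtain ⟨l, -, rfl⟩ := List.mem_map.1 hx
    rcases hc with ⟨k, rfl⟩ | ⟨k, rfl⟩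
    · exact h.diag_comm k l
    · exact Commute.units_inv_left (u := ⟨_, u k, h.invR k, h.invL k⟩) (h.diag_comm k l)
  | algebraMap r => exact Algebra.commute_algebraMap_left r _
  | add c d _ _ hc hd => exact hc.add_left hd
  | mul c d _ _ hc hd => exact hc.mul_left hd

lemma IsSpPair.exists_zProd_eq (h : IsSpPair q S u) (k : Fin n) :
    ∃ w ∈ Algebra.adjoin F (Set.range fun k => S (fe n k) (fo n k)),
      zProd S = S (fe n k) (fo n k) * w := by
  have hz (l) : S (fe n l) (fo n l) ∈ Algebra.adjoin F (Set.range fun k => S (fe n k) (fo n k)) :=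
    Algebra.subset_adjoin ⟨l, rfl⟩
  obtain ⟨a, b, hab⟩ := List.append_of_mem (List.mem_finRange k)
  refine ⟨(a.map fun k => S (fe n k) (fo n k)).prod * (b.map fun k => S (fe n k) (fo n k)).prod,
    mul_mem ?_ ?_, ?_⟩
  · exact Subalgebra.list_prod_mem _ fun x hx => by
      obtain ⟨l, -, rfl⟩ := List.mem_map.1 hx; exact hz l
  · exact Subalgebra.list_prod_mem _ fun x hx => by
      obtain ⟨l, -, rfl⟩ := List.mem_map.1 hx; exact hz l
  · rw [zProd, hab, List.map_append, List.prod_append, List.map_cons, List.prod_cons,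
      ← mul_assoc, ← mul_assoc]
    congr 1
    refine (Commute.list_prod_right _ _ fun x hx => ?_).eq.symm
    obtain ⟨l, -, rfl⟩ := List.mem_map.1 hx
    exact h.diag_comm k l

lemma IsSpPair.exists_mul_zProd_pow (h : IsSpPair q S u) {c : A} (hc : c ∈ torus F S u) :
    ∃ M, c * zProd S ^ M ∈ Algebra.adjoin F (Set.range fun k => S (fe n k) (fo n k)) := by
  have hZ : zProd S ∈ Algebra.adjoin F (Set.range fun k => S (fe n k) (fo n k)) :=
    Subalgebra.list_prod_mem _ fun x hx => by
      obtain ⟨l, -, rfl⟩ := List.mem_map.1 hx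
      exact Algebra.subset_adjoin ⟨l, rfl⟩
  induction hc using Algebra.adjoin_induction with
  | mem c hc =>
    rcases hc with ⟨k, rfl⟩ | ⟨k, rfl⟩
    · exact ⟨0, by
        rw [pow_zero, mul_one]
        exact Algebra.subset_adjoin ⟨k, rfl⟩⟩
    · obtain ⟨w, hw, h1⟩ := h.exists_zProd_eq (F := F) k
      refine ⟨1, ?_⟩
      rwa [pow_one, h1, ← mul_assoc, h.invL, one_mul]
  | algebraMap r => exact ⟨0, by simp⟩
  | add c d _ _ hc hd =>
    obtain ⟨M, h1⟩ := hc
    obtain ⟨M', h2⟩ := hd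
    refine ⟨M + M', ?_⟩
    rw [add_mul]
    nth_rw 1 [pow_add]
    rw [add_comm M, pow_add, ← mul_assoc, ← mul_assoc]
    exact add_mem (mul_mem h1 (pow_mem hZ _)) (mul_mem h2 (pow_mem hZ _))
  | mul c d _ hd' hc hd =>
    obtain ⟨M, h1⟩ := hc
    obtain ⟨M', h2⟩ := hd
    refine ⟨M + M', ?_⟩
    rw [pow_add, mul_assoc, ← mul_assoc d, ((h.commute_zProd hd').pow_right M).eq, mul_assoc,
      ← mul_assoc c]
    exact mul_mem h1 h2

/-- Every element of the presented algebra becomes a combination of ordered monomials after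
multiplication by a power of the product of the `s_{ii'}`. -/
theorem IsSpPair.exists_mul_pow_mem (h : IsSpPair q S u) (hq : q ≠ 0) (qR : Rˣ)
    (hqR : algebraMap R F qR = q) (hq1 : (qR : R) - 1 ∈ IsLocalRing.maximalIdeal R)
    (hgen : Algebra.adjoin F (Set.range (entry S) ∪ Set.range u) = ⊤) (f : A) :
    ∃ M, f * zProd S ^ M ∈
      orderedSpan F (entry S) (offPairs n ++ diagPairs (List.finRange n) ++ upPairs n) := by
  have hf := h.mem_mul_torus hq qR hqR hq1 hgen f
  rw [orderedSpan_append _ _ (upPairs n)]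
  suffices ∃ M, f * zProd S ^ M ∈
      orderedSpan F (entry S) (offPairs n ++ diagPairs (List.finRange n)) *
        (Algebra.adjoin F (Set.range fun k => S (fe n k) (fo n k))).toSubmodule by
    obtain ⟨M, hM⟩ := this
    exact ⟨M, mul_le_mul_right h.adjoin_le_upPairs _ hM⟩
  set D := Algebra.adjoin F (Set.range fun k => S (fe n k) (fo n k))
  have hZ (M : ℕ) : zProd S ^ M ∈ D :=
    pow_mem (Subalgebra.list_prod_mem _ fun x hx => by
      obtain ⟨l, -, rfl⟩ := List.mem_map.1 hx
      exact Algebra.subset_adjoin ⟨l, rfl⟩) M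
  have hmul (V : Submodule F A) {x : A} (hx : x ∈ V * D.toSubmodule) (M : ℕ) :
      x * zProd S ^ M ∈ V * D.toSubmodule := by
    have := Submodule.mul_mem_mul hx ((Subalgebra.mem_toSubmodule D).2 (hZ M))
    rwa [mul_assoc, D.isIdempotentElem_toSubmodule.eq] at this
  refine Submodule.mul_induction_on hf (fun m hm c hc => ?_) fun x y hx hy => ?_
  · obtain ⟨M, hM⟩ := h.exists_mul_zProd_pow hc
    exact ⟨M, by rw [mul_assoc]; exact Submodule.mul_mem_mul hm hM⟩
  · obtain ⟨M, h1⟩ := hx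
    obtain ⟨M', h2⟩ := hy
    refine ⟨M + M', ?_⟩
    rw [add_mul]
    nth_rw 1 [pow_add]
    rw [add_comm M, pow_add, ← mul_assoc, ← mul_assoc]
    exact add_mem (hmul _ h1 _) (hmul _ h2 _)

end Spanning

section Products

variable {F : Type} [Field F] {q : F} {N : ℕ} {A : Type} [Ring A] [Algebra F A]

lemma rtt_mul {X Y X' Y' : Matrix (Fin N) (Fin N) A}
    (h : rttLHS F q X Y = rttRHS F q X Y) (h' : rttLHS F q X' Y' = rttRHS F q X' Y')
    (hXY : ∀ i j k l, Commute (X' i j) (Y k l)) (hYX : ∀ i j k l, Commute (X i j) (Y' k l)) :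
    rttLHS F q (X * X') (Y * Y') = rttRHS F q (X * X') (Y * Y') := by
  simp only [rttLHS, rttRHS, amp1_mul, amp2_mul] at *
  set R : Matrix _ _ A := liftF F (Rc F q N)
  have h1 := amp1_mul_amp2_comm hXY
  have h2 := amp1_mul_amp2_comm hYX
  calc _ = R * amp1 X * (amp1 X' * amp2 Y) * amp2 Y' := by simp only [Matrix.mul_assoc]
    _ = (R * amp1 X * amp2 Y) * amp1 X' * amp2 Y' := by rw [h1]; simp only [Matrix.mul_assoc]
    _ = amp2 Y * amp1 X * (R * amp1 X' * amp2 Y') := by rw [h]; simp only [Matrix.mul_assoc]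
    _ = amp2 Y * (amp1 X * amp2 Y') * amp1 X' * R := by rw [h']; simp only [Matrix.mul_assoc]
    _ = _ := by rw [h2]; simp only [Matrix.mul_assoc]

lemma IsGlPair.mul {T Tb T' Tb' : Matrix (Fin N) (Fin N) A} (h : IsGlPair q T Tb)
    (h' : IsGlPair q T' Tb') (h1 : ∀ i j k l, Commute (T i j) (T' k l))
    (h2 : ∀ i j k l, Commute (T i j) (Tb' k l)) (h3 : ∀ i j k l, Commute (Tb i j) (T' k l))
    (h4 : ∀ i j k l, Commute (Tb i j) (Tb' k l)) : IsGlPair q (T * T') (Tb * Tb') := by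
  have hd (i) : (T * T') i i = T i i * T' i i := by
    rw [Matrix.mul_apply]
    refine Finset.sum_eq_single i (fun k _ hk => ?_) (by simp)
    rcases hk.lt_or_gt with hk | hk
    · rw [h'.t_zero _ _ hk, mul_zero]
    · rw [h.t_zero _ _ hk, zero_mul]
  have hdb (i) : (Tb * Tb') i i = Tb i i * Tb' i i := by
    rw [Matrix.mul_apply]
    refine Finset.sum_eq_single i (fun k _ hk => ?_) (by simp)
    rcases hk.lt_or_gt with hk | hk
    · rw [h.tb_zero _ _ hk, zero_mul]
    · rw [h'.tb_zero _ _ hk, mul_zero]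
  refine ⟨fun i j hij => ?_, fun i j hij => ?_, fun i => ?_, fun i => ?_,
    rtt_mul h.rtt h'.rtt (fun i j k l => (h1 k l i j).symm) h1,
    rtt_mul h.rtbtb h'.rtbtb (fun i j k l => (h4 k l i j).symm) h4,
    rtt_mul h.rtbt h'.rtbt (fun i j k l => (h2 k l i j).symm) h3⟩
  · rw [Matrix.mul_apply]
    refine Finset.sum_eq_zero fun k _ => ?_
    rcases lt_or_ge i k with hk | hk
    · rw [h.t_zero _ _ hk, zero_mul]
    · rw [h'.t_zero _ _ (hk.trans_lt hij), mul_zero]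
  · rw [Matrix.mul_apply]
    refine Finset.sum_eq_zero fun k _ => ?_
    rcases lt_or_ge k i with hk | hk
    · rw [h.tb_zero _ _ hk, zero_mul]
    · rw [h'.tb_zero _ _ (hij.trans_le hk), mul_zero]
  · rw [hd, hdb, (h3 i i i i).symm.mul_mul_mul_comm, h.t_tb, h'.t_tb, mul_one]
  · rw [hd, hdb, (h2 i i i i).symm.mul_mul_mul_comm, h.tb_t, h'.tb_t, mul_one]

lemma isGlPair_one : IsGlPair q (1 : Matrix (Fin N) (Fin N) A) 1 := by
  have h : rttLHS F q (1 : Matrix (Fin N) (Fin N) A) 1 = rttRHS F q 1 1 := by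
    have h1 : amp1 (1 : Matrix (Fin N) (Fin N) A) = 1 := by
      ext p r
      simp [amp1, Matrix.one_apply, Prod.ext_iff, ← ite_and, and_comm]
    have h2 : amp2 (1 : Matrix (Fin N) (Fin N) A) = 1 := by
      ext p r
      simp [amp2, Matrix.one_apply, Prod.ext_iff, ite_and]
    simp [rttLHS, rttRHS, h1, h2]
  exact ⟨fun i j h => Matrix.one_apply_ne h.ne, fun i j h => Matrix.one_apply_ne h.ne',
    by simp, by simp, h, h, h⟩

lemma IsGlPair.map {B : Type} [Ring B] [Algebra F B] {T Tb : Matrix (Fin N) (Fin N) A}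
    (h : IsGlPair q T Tb) (f : A →ₐ[F] B) : IsGlPair q (T.map f) (Tb.map f) := by
  refine ⟨fun i j hij => ?_, fun i j hij => ?_, fun i => ?_, fun i => ?_, ?_, ?_, ?_⟩
  · rw [Matrix.map_apply, h.t_zero i j hij, map_zero]
  · rw [Matrix.map_apply, h.tb_zero i j hij, map_zero]
  · rw [Matrix.map_apply, Matrix.map_apply, ← map_mul, h.t_tb, map_one]
  · rw [Matrix.map_apply, Matrix.map_apply, ← map_mul, h.tb_t, map_one]
  all_goals
    ext p r
    rw [← map_rttLHS_apply, ← map_rttRHS_apply]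
  · rw [h.rtt]
  · rw [h.rtbtb]
  · rw [h.rtbt]

end Products

section Vector

variable {F : Type} [Field F] {q : F} {N : ℕ}

/-- The matrix `1 + ∑ c i j • E j i` over the algebra of scalar matrices. -/
def unipMat (c : Fin N → Fin N → F) : Matrix (Fin N) (Fin N) (Matrix (Fin N) (Fin N) F) :=
  Matrix.of fun i j => (if i = j then 1 else 0) + c i j • Matrix.single j i 1

lemma unipMat_mul_unipMat (c d : Fin N → Fin N → F) (i j a b : Fin N) :
    unipMat c i a * unipMat d j b = (if i = a ∧ j = b then 1 else 0)
      + (if i = a then d j b • Matrix.single b j 1 else 0)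
      + (if j = b then c i a • Matrix.single a i 1 else 0)
      + (if i = b then (c i a * d j b) • Matrix.single a j 1 else 0) := by
  have hE : Matrix.single a i (1 : F) * Matrix.single b j 1
      = if i = b then Matrix.single a j 1 else 0 := by
    split_ifs with h
    · rw [h, Matrix.single_mul_single_same, one_mul]
    · exact Matrix.single_mul_single_of_ne _ _ _ _ h _
  simp only [unipMat, Matrix.of_apply, add_mul, mul_add, hE, smul_ite, smul_zero,
    mul_smul_comm, smul_mul_assoc, ite_mul, mul_ite, one_mul, mul_one, zero_mul, mul_zero, ite_and]
  split_ifs <;> module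

/-- The coefficients of `T` in the vector representation. -/
def vecT (q : F) (i j : Fin N) : F := if i = j then q⁻¹ - 1 else if j < i then q⁻¹ - q else 0

/-- The coefficients of `T̄` in the vector representation. -/
def vecTb (q : F) (i j : Fin N) : F := if i = j then q - 1 else if i < j then q - q⁻¹ else 0

set_option maxHeartbeats 1000000 in
lemma vec_rtt {c d : Fin N → Fin N → F}
   (h : (c = vecT q ∧ d = vecT q) ∨ (c = vecTb q ∧ d = vecTb q) ∨ (c = vecTb q ∧ d = vecT q))
   (hq : q ≠ 0) :
    rttLHS F q (unipMat c) (unipMat d) = rttRHS F q (unipMat c) (unipMat d) := by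
  refine Matrix.ext fun ⟨i, j⟩ ⟨a, b⟩ => ?_
  simp only [rttLHS_apply, rttRHS_apply, unipMat_mul_unipMat]
  rcases eq_or_ne i a with rfl | h1
  · obtain ⟨rfl, rfl⟩ | ⟨rfl, rfl⟩ | ⟨rfl, rfl⟩ := h <;>
    rcases lt_trichotomy i j with h | h | h <;> rcases lt_trichotomy i b with h' | h' | h' <;>
    rcases lt_trichotomy j b with h'' | h'' | h'' <;> first | (exfalso; order) | skip
    all_goals
      subst_vars
      simp [Rdiag, Roff, vecT, vecTb, *, ne_of_lt, ne_of_gt, not_lt_of_gt, -Matrix.smul_single]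
      try match_scalars <;> field_simp <;> ring
  rcases eq_or_ne j b with rfl | h2
  · obtain ⟨rfl, rfl⟩ | ⟨rfl, rfl⟩ | ⟨rfl, rfl⟩ := h <;>
    rcases lt_trichotomy i j with h | h | h <;> rcases lt_trichotomy i a with h' | h' | h' <;>
    rcases lt_trichotomy j a with h'' | h'' | h'' <;> first | (exfalso; order) | skip
    all_goals
      subst_vars
      simp [Rdiag, Roff, vecT, vecTb, *, ne_of_lt, ne_of_gt, not_lt_of_gt, -Matrix.smul_single]
      try match_scalars <;> field_simp <;> ring
  rcases eq_or_ne i b with rfl | h3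
  · obtain ⟨rfl, rfl⟩ | ⟨rfl, rfl⟩ | ⟨rfl, rfl⟩ := h <;>
    rcases lt_trichotomy i j with h | h | h <;> rcases lt_trichotomy i a with h' | h' | h' <;>
    rcases lt_trichotomy j a with h'' | h'' | h'' <;> first | (exfalso; order) | skip
    all_goals
      subst_vars
      simp [Rdiag, Roff, vecT, vecTb, *, ne_of_lt, ne_of_gt, not_lt_of_gt, -Matrix.smul_single]
      try match_scalars <;> field_simp <;> ring
  rcases eq_or_ne j a with rfl | h4
  · obtain ⟨rfl, rfl⟩ | ⟨rfl, rfl⟩ | ⟨rfl, rfl⟩ := h <;>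
    rcases lt_trichotomy i j with h | h | h <;> rcases lt_trichotomy i b with h' | h' | h' <;>
    rcases lt_trichotomy j b with h'' | h'' | h'' <;> first | (exfalso; order) | skip
    all_goals
      simp [Rdiag, Roff, vecT, vecTb, *, ne_of_lt, ne_of_gt, not_lt_of_gt, -Matrix.smul_single]
      try match_scalars <;> field_simp <;> ring
  simp [h1, h2, h3, h4]

lemma isGlPair_vec (hq : q ≠ 0) :
    IsGlPair q (unipMat (N := N) (vecT q)) (unipMat (vecTb q)) := by
  refine ⟨fun i j h => ?_, fun i j h => ?_, fun i => ?_, fun i => ?_,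
    vec_rtt (.inl ⟨rfl, rfl⟩) hq, vec_rtt (.inr (.inl ⟨rfl, rfl⟩)) hq,
    vec_rtt (.inr (.inr ⟨rfl, rfl⟩)) hq⟩
  · simp [unipMat, vecT, h.ne, h.not_gt]
  · simp [unipMat, vecTb, h.ne', h.not_gt]
  all_goals
    rw [unipMat_mul_unipMat]
    simp only [and_self, if_true, vecT, vecTb]
    match_scalars <;> field_simp <;> ring

end Vector

section Kronecker

open scoped Kronecker

variable {F : Type} [CommRing F] {I J : Type}

/-- Apply a linear functional in the second tensor factor. -/
def kronContract (f : Matrix J J F →ₗ[F] F) : Matrix (I × J) (I × J) F →ₗ[F] Matrix I I F where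
  toFun M := Matrix.of fun i j => f (Matrix.of fun a b => M (i, a) (j, b))
  map_add' M M' := by
    ext i j
    exact map_add f (Matrix.of fun a b => M (i, a) (j, b)) (Matrix.of fun a b => M' (i, a) (j, b))
  map_smul' r M := by
    ext i j
    exact map_smul f r (Matrix.of fun a b => M (i, a) (j, b))

lemma kronContract_kronecker (f : Matrix J J F →ₗ[F] F) (M : Matrix I I F) (M' : Matrix J J F) :
    kronContract f (M ⊗ₖ M') = f M' • M := by
  ext i j
  have : (Matrix.of fun a b => (M ⊗ₖ M') (i, a) (j, b)) = M i j • M' := by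
    ext a b; simp
  change f (Matrix.of fun a b => (M ⊗ₖ M') (i, a) (j, b)) = _
  rw [this]
  simp [mul_comm]

variable [Fintype I] [DecidableEq I] [Fintype J] [DecidableEq J]

/-- The algebra homomorphism `M ↦ M ⊗ 1`. -/
def kronLeft : Matrix I I F →ₐ[F] Matrix (I × J) (I × J) F where
  toFun M := M ⊗ₖ 1
  map_one' := Matrix.one_kronecker_one
  map_mul' M M' := by rw [← Matrix.mul_kronecker_mul, one_mul]
  map_zero' := Matrix.zero_kronecker _
  map_add' M M' := Matrix.add_kronecker ..
  commutes' r := by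
    rw [Algebra.algebraMap_eq_smul_one, Algebra.algebraMap_eq_smul_one, Matrix.smul_kronecker,
      Matrix.one_kronecker_one]

/-- The algebra homomorphism `M ↦ 1 ⊗ M`. -/
def kronRight : Matrix J J F →ₐ[F] Matrix (I × J) (I × J) F where
  toFun M := 1 ⊗ₖ M
  map_one' := Matrix.one_kronecker_one
  map_mul' M M' := by rw [← Matrix.mul_kronecker_mul, one_mul]
  map_zero' := Matrix.kronecker_zero _
  map_add' M M' := Matrix.kronecker_add ..
  commutes' r := by
    rw [Algebra.algebraMap_eq_smul_one, Algebra.algebraMap_eq_smul_one, Matrix.kronecker_smul,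
      Matrix.one_kronecker_one]

lemma kronLeft_mul_kronRight (M : Matrix I I F) (M' : Matrix J J F) :
    kronLeft M * kronRight M' = M ⊗ₖ M' := by
  simp [kronLeft, kronRight, ← Matrix.mul_kronecker_mul]

lemma commute_kronLeft_kronRight (M : Matrix I I F) (M' : Matrix J J F) :
    Commute (kronLeft M) (kronRight M') := by
  simp [kronLeft, kronRight, ← Matrix.mul_kronecker_mul, Commute, SemiconjBy]

end Kronecker

section Words

open scoped Kronecker

variable {k : Type} [Field k] {I J : Type} [Fintype I] [DecidableEq I] [Fintype J] [DecidableEq J]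

/-- The product of the matrices `κ + D Z` over a list of pairs `(κ, Z)`. -/
def wordProd (D : Matrix J J k →ₗ[k] Matrix I I k) (w : List (k × Matrix J J k)) : Matrix I I k :=
  (w.map fun c => c.1 • (1 : Matrix I I k) + D c.2).prod

/-- The coproduct `D ⊗ 1 + 1 ⊗ id`. -/
def extendRep (D : Matrix J J k →ₗ[k] Matrix I I k) :
    Matrix J J k →ₗ[k] Matrix (I × J) (I × J) k :=
  kronLeft.toLinearMap ∘ₗ D + kronRight.toLinearMap

lemma wordProd_extendRep_sub_mem (D : Matrix J J k →ₗ[k] Matrix I I k)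
    (w : List (k × Matrix J J k)) :
    wordProd (extendRep D) w - wordProd D w ⊗ₖ 1
        - ∑ i : Fin w.length, wordProd D (w.eraseIdx i) ⊗ₖ (w.get i).2
      ∈ Submodule.span k {M | ∃ u Z, u.length + 2 ≤ w.length ∧ M = wordProd D u ⊗ₖ Z} := by
  induction w with
  | nil => simp [wordProd]
  | cons c w ih =>
    obtain ⟨κ, Z⟩ := c
    set y := κ • (1 : Matrix I I k) + D Z with hy
    have hc (u) : wordProd D ((κ, Z) :: u) = y * wordProd D u := by simp [wordProd, hy]
    have hc' (u) : wordProd (extendRep D) ((κ, Z) :: u)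
        = (y ⊗ₖ 1 + 1 ⊗ₖ Z) * wordProd (extendRep D) u := by
      simp [wordProd, hy, extendRep, kronLeft, kronRight, Matrix.add_kronecker,
        Matrix.smul_kronecker, add_assoc]
    set E := wordProd (extendRep D) w - wordProd D w ⊗ₖ 1
        - ∑ i : Fin w.length, wordProd D (w.eraseIdx i) ⊗ₖ (w.get i).2 with hE
    have hw : wordProd (extendRep D) w = wordProd D w ⊗ₖ 1
        + ∑ i : Fin w.length, wordProd D (w.eraseIdx i) ⊗ₖ (w.get i).2 + E := by
      rw [hE]; abel
    have hs : ∑ i : Fin ((κ, Z) :: w).length,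
        wordProd D (((κ, Z) :: w).eraseIdx i) ⊗ₖ (((κ, Z) :: w).get i).2
        = wordProd D w ⊗ₖ Z
          + ∑ i : Fin w.length, (y * wordProd D (w.eraseIdx i)) ⊗ₖ (w.get i).2 := by
      refine (Fin.sum_univ_succ (n := w.length) _).trans ?_
      simp [hc]
    have key : wordProd (extendRep D) ((κ, Z) :: w) - wordProd D ((κ, Z) :: w) ⊗ₖ 1
        - ∑ i : Fin ((κ, Z) :: w).length,
          wordProd D (((κ, Z) :: w).eraseIdx i) ⊗ₖ (((κ, Z) :: w).get i).2
        = (y ⊗ₖ 1 + 1 ⊗ₖ Z) * E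
          + ∑ i : Fin w.length, wordProd D (w.eraseIdx i) ⊗ₖ (Z * (w.get i).2) := by
      rw [hs, hc', hc, hw]
      simp only [add_mul, mul_add, Finset.mul_sum, Finset.sum_add_distrib,
        ← Matrix.mul_kronecker_mul,
        one_mul, mul_one]
      abel
    rw [key]
    refine add_mem ?_ (sum_mem fun i _ => Submodule.subset_span ⟨_, _, ?_, rfl⟩)
    · generalize E = E' at ih
      induction ih using Submodule.span_induction with
      | mem M hM =>
        obtain ⟨u, Z', hu, rfl⟩ := hM
        rw [add_mul, ← Matrix.mul_kronecker_mul, ← Matrix.mul_kronecker_mul, ← hc, one_mul, one_mul]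
        refine add_mem (Submodule.subset_span ⟨_, _, ?_, rfl⟩)
          (Submodule.subset_span ⟨_, _, ?_, rfl⟩) <;> simp only [List.length_cons] <;> omega
      | zero => simp
      | add M M' _ _ h h' => rw [mul_add]; exact add_mem h h'
      | smul r M _ h => rw [mul_smul_comm]; exact Submodule.smul_mem _ _ h
    · have := i.isLt
      simp only [List.length_cons, List.length_eraseIdx, this, if_true]
      omega

/-- Linear functionals on `Mat_I` detecting the top degree part of polynomials in `κ + D Z`. -/
def Detects (D : Matrix J J k →ₗ[k] Matrix I I k) (d : ℕ) : Prop :=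
  ∀ f : Matrix J J k →ₗ[k] k, f 1 = 0 → ∃ Φ : Matrix I I k →ₗ[k] k, ∀ w,
    (w.length < d → Φ (wordProd D w) = 0) ∧
      (w.length = d → Φ (wordProd D w) = d.factorial * (w.map fun c => f c.2).prod)

lemma Detects.extendRep {D : Matrix J J k →ₗ[k] Matrix I I k} {d : ℕ} (h : Detects D d) :
    Detects (extendRep D) (d + 1) := by
  intro f hf
  obtain ⟨Φ, hΦ⟩ := h f hf
  have hE (w : List (k × Matrix J J k)) (hw : w.length ≤ d + 1) :
      Φ (kronContract f (wordProd (_root_.extendRep D) w))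
        = ∑ i : Fin w.length, f (w.get i).2 * Φ (wordProd D (w.eraseIdx i)) := by
    have : Submodule.span k {M | ∃ u Z, u.length + 2 ≤ w.length ∧ M = wordProd D u ⊗ₖ Z}
        ≤ LinearMap.ker (Φ ∘ₗ kronContract f) := by
      rw [Submodule.span_le]
      rintro _ ⟨u, Z, hu, rfl⟩
      simp [kronContract_kronecker, (hΦ u).1 (by omega)]
    have := this (wordProd_extendRep_sub_mem D w)
    simp only [LinearMap.mem_ker, LinearMap.comp_apply, map_sub, map_sum, kronContract_kronecker,
      hf, zero_smul, map_zero, sub_zero, map_smul, smul_eq_mul] at this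
    exact sub_eq_zero.1 this
  refine ⟨Φ ∘ₗ kronContract f, fun w => ⟨fun hw => ?_, fun hw => ?_⟩⟩
  · rw [LinearMap.comp_apply, hE w hw.le]
    refine Finset.sum_eq_zero fun i _ => ?_
    have := i.isLt
    rw [(hΦ _).1 (by simp only [List.length_eraseIdx, this, if_true]; omega), mul_zero]
  · rw [LinearMap.comp_apply, hE w hw.le]
    have (i : Fin w.length) : f (w.get i).2 * Φ (wordProd D (w.eraseIdx i))
        = d.factorial * (w.map fun c => f c.2).prod := by
      have hi := i.isLt
      rw [(hΦ _).2 (by simp only [List.length_eraseIdx, hi, if_true]; omega)]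
      have := (List.getElem_cons_eraseIdx_perm hi).map fun c => f c.2
      rw [← this.prod_eq]
      simp
      ring
    simp only [this, Finset.sum_const, Finset.card_univ, Fintype.card_fin, hw, nsmul_eq_mul,
      Nat.factorial_succ]
    push_cast
    ring

end Words

section Deformation

open scoped Kronecker

variable {R : Type} [CommRing R] {F : Type} [Field F] [Algebra R F] {k : Type} [Field k] {N : ℕ}
  {I J : Type} [Fintype I] [DecidableEq I] [Fintype J] [DecidableEq J]

/-- The matrix `1 + (q - 1) X`, with scalars extended to `F`. -/
def defMat (F : Type) [Field F] [Algebra R F] {I : Type} [DecidableEq I] (qR : R)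
    (X : Fin N → Fin N → Matrix I I R) : Matrix (Fin N) (Fin N) (Matrix I I F) :=
  Matrix.of fun i j => ((if i = j then 1 else 0) + (qR - 1) • X i j).map (algebraMap R F)

/-- The first order term of `T` in the vector representation. -/
def limT (k : Type) [Field k] (i j : Fin N) : Matrix (Fin N) (Fin N) k :=
  if i = j then Matrix.single i i (-1) else if j < i then Matrix.single j i (-2) else 0

/-- The first order term of `T̄` in the vector representation. -/
def limTb (k : Type) [Field k] (i j : Fin N) : Matrix (Fin N) (Fin N) k :=
  if i = j then Matrix.single i i 1 else if i < j then Matrix.single j i 2 else 0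

/-- A representation of `U_q(gl_N)` which is trivial to zeroth order at `q = 1` and given to first
order by `D`. -/
structure IsDefRep (F : Type) [Field F] [Algebra R F] (ε : R →+* k) (qR : Rˣ)
    (X Xb : Fin N → Fin N → Matrix I I R)
    (D : Matrix (Fin N) (Fin N) k →ₗ[k] Matrix I I k) : Prop where
  pair : IsGlPair (algebraMap R F qR) (defMat F (qR : R) X) (defMat F (qR : R) Xb)
  lim : ∀ i j, (X i j).map ε = D (limT k i j)
  limb : ∀ i j, (Xb i j).map ε = D (limTb k i j)

/-- First order terms of `T` in the vector representation. -/
def vecX (qR : Rˣ) (i j : Fin N) : Matrix (Fin N) (Fin N) R :=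
  if i = j then Matrix.single i i (-(↑qR⁻¹ : R)) else
    if j < i then Matrix.single j i (-(1 + (↑qR⁻¹ : R))) else 0

/-- First order terms of `T̄` in the vector representation. -/
def vecXb (qR : Rˣ) (i j : Fin N) : Matrix (Fin N) (Fin N) R :=
  if i = j then Matrix.single i i 1 else
    if i < j then Matrix.single j i (1 + (↑qR⁻¹ : R)) else 0

lemma algebraMap_units_inv (qR : Rˣ) : algebraMap R F ↑qR⁻¹ = (algebraMap R F qR)⁻¹ :=
  eq_inv_of_mul_eq_one_left (by rw [← map_mul, Units.inv_mul, map_one])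

lemma map_scalar_add_single (p : Prop) [Decidable p] (c r : R) (a b : Fin N) :
    ((if p then 1 else 0) + c • Matrix.single a b r).map (algebraMap R F)
      = (if p then 1 else 0) + algebraMap R F (c * r) • Matrix.single a b 1 := by
  refine Matrix.ext fun x y => ?_
  split_ifs <;> simp [Matrix.single_apply, Matrix.one_apply, apply_ite (algebraMap R F)]

lemma isDefRep_vec {ε : R →+* k} {qR : Rˣ} (hε : ε qR = 1) :
    IsDefRep F ε qR (vecX (N := N) qR) (vecXb qR) LinearMap.id := by
  have hq : algebraMap R F qR ≠ 0 := (qR.isUnit.map (algebraMap R F)).ne_zero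
  have hε' : ε ↑qR⁻¹ = 1 := by
    have : ε (↑qR⁻¹ * qR) = 1 := by rw [Units.inv_mul, map_one]
    rwa [map_mul, hε, mul_one] at this
  have hX : defMat F (qR : R) (vecX (N := N) qR) = unipMat (vecT (algebraMap R F qR)) := by
    refine Matrix.ext fun i j => ?_
    have : vecX qR i j = Matrix.single j i
        (if i = j then -(↑qR⁻¹ : R) else if j < i then -(1 + (↑qR⁻¹ : R)) else 0) := by
      unfold vecX
      split_ifs with h <;> simp [h]
    simp only [defMat, unipMat, Matrix.of_apply, this, map_scalar_add_single]
    congr 2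
    unfold vecT
    split_ifs <;> simp only [map_mul, map_sub, map_one, map_neg, map_add, map_zero, mul_zero,
      algebraMap_units_inv]
    all_goals (field_simp; try ring)
  have hXb : defMat F (qR : R) (vecXb (N := N) qR) = unipMat (vecTb (algebraMap R F qR)) := by
    refine Matrix.ext fun i j => ?_
    have : vecXb qR i j = Matrix.single j i
        (if i = j then 1 else if i < j then 1 + (↑qR⁻¹ : R) else 0) := by
      unfold vecXb
      split_ifs with h <;> simp [h]
    simp only [defMat, unipMat, Matrix.of_apply, this, map_scalar_add_single]
    congr 2
    unfold vecTb
    split_ifs <;> simp only [map_mul, map_sub, map_one, map_neg, map_add, map_zero, mul_zero,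
      mul_one, algebraMap_units_inv]
    all_goals (field_simp; try ring)
  refine ⟨?_, fun i j => ?_, fun i j => ?_⟩
  · rw [hX, hXb]
    exact isGlPair_vec hq
  · unfold vecX limT
    refine Matrix.ext fun a b => ?_
    split_ifs <;> simp [Matrix.single_apply, apply_ite ε, hε']; norm_num
  · unfold vecXb limTb
    refine Matrix.ext fun a b => ?_
    split_ifs <;> simp [Matrix.single_apply, apply_ite ε, hε']; norm_num

/-- First order terms of the product of two matrices `1 + (q - 1) X`, `1 + (q - 1) Y`. -/
def extendX (qR : R) (X : Fin N → Fin N → Matrix I I R) (Y : Fin N → Fin N → Matrix J J R)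
    (i j : Fin N) : Matrix (I × J) (I × J) R :=
  X i j ⊗ₖ 1 + 1 ⊗ₖ Y i j + (qR - 1) • ∑ l, X i l ⊗ₖ Y l j

lemma defMat_extendX (qR : R) (X : Fin N → Fin N → Matrix I I R)
    (Y : Fin N → Fin N → Matrix J J R) :
    defMat F qR (extendX qR X Y)
      = (defMat F qR X).map kronLeft * (defMat F qR Y).map kronRight := by
  have hmap (M : Matrix I I R) (M' : Matrix J J R) :
      M.map (algebraMap R F) ⊗ₖ M'.map (algebraMap R F) = (M ⊗ₖ M').map (algebraMap R F) := by
    refine Matrix.ext fun _ _ => ?_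
    simp
  have hsum (M : Fin N → Matrix (I × J) (I × J) R) :
      ∑ l, (M l).map (algebraMap R F) = (∑ l, M l).map (algebraMap R F) :=
    (map_sum (algebraMap R F).mapMatrix M Finset.univ).symm
  refine Matrix.ext fun i j => ?_
  simp only [Matrix.mul_apply, Matrix.map_apply, kronLeft_mul_kronRight]
  simp only [defMat, Matrix.of_apply, hmap, hsum]
  congr 1
  have hterm (l : Fin N) : ((if i = l then 1 else 0) + (qR - 1) • X i l)
        ⊗ₖ ((if l = j then 1 else 0) + (qR - 1) • Y l j)
      = (if i = l then (if l = j then 1 else 0) else 0)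
        + (if i = l then (qR - 1) • (1 : Matrix I I R) ⊗ₖ Y l j else 0)
        + (if l = j then (qR - 1) • X i l ⊗ₖ (1 : Matrix J J R) else 0)
        + (qR - 1) • (qR - 1) • X i l ⊗ₖ Y l j := by
    split_ifs <;> simp only [Matrix.add_kronecker, Matrix.kronecker_add, Matrix.smul_kronecker,
      Matrix.kronecker_smul, Matrix.one_kronecker_one, Matrix.zero_kronecker,
      Matrix.kronecker_zero, smul_add, smul_zero] <;> abel
  simp only [hterm, Finset.sum_add_distrib, Finset.sum_ite_eq, Finset.sum_ite_eq',
    Finset.mem_univ, if_true, extendX, ← Finset.smul_sum, smul_add]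
  abel

lemma IsDefRep.extend {ε : R →+* k} {qR : Rˣ} (hε : ε qR = 1)
    {X Xb : Fin N → Fin N → Matrix I I R} {D : Matrix (Fin N) (Fin N) k →ₗ[k] Matrix I I k}
    (h : IsDefRep F ε qR X Xb D) :
    IsDefRep F ε qR (extendX (qR : R) X (vecX qR)) (extendX (qR : R) Xb (vecXb qR))
      (extendRep D) := by
  have hv := isDefRep_vec (F := F) (N := N) hε
  have hlim (X : Fin N → Fin N → Matrix _ _ R) (Y : Fin N → Fin N → Matrix (Fin N) (Fin N) R)
      (i j : Fin N) : (extendX (I := I) (qR : R) X Y i j).map ε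
        = kronLeft ((X i j).map ε) + kronRight ((Y i j).map ε) := by
    refine Matrix.ext fun _ _ => ?_
    simp [extendX, kronLeft, kronRight, hε, Matrix.one_apply, apply_ite ε]
  refine ⟨?_, fun i j => ?_, fun i j => ?_⟩
  · rw [defMat_extendX, defMat_extendX]
    have h1 := h.pair.map (kronLeft (J := Fin N))
    have h2 := hv.pair.map (kronRight (I := I))
    have hc (M : Matrix I I F) (M' : Matrix (Fin N) (Fin N) F) :
        Commute (kronLeft M) (kronRight M') := commute_kronLeft_kronRight M M'
    refine h1.mul h2 ?_ ?_ ?_ ?_ <;> intros <;> exact hc _ _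
  · rw [hlim, h.lim, hv.lim]
    simp [extendRep]
  · rw [hlim, h.limb, hv.limb]
    simp [extendRep]

theorem exists_isDefRep {ε : R →+* k} {qR : Rˣ} (hε : ε qR = 1) (d : ℕ) :
    ∃ (I : Type) (_ : Fintype I) (_ : DecidableEq I) (X Xb : Fin N → Fin N → Matrix I I R)
      (D : Matrix (Fin N) (Fin N) k →ₗ[k] Matrix I I k),
      IsDefRep F ε qR X Xb D ∧ Detects D d := by
  induction d with
  | zero =>
    refine ⟨Unit, inferInstance, inferInstance, 0, 0, 0, ⟨?_, ?_, ?_⟩, fun f _ => ?_⟩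
    · have : defMat F (qR : R) (0 : Fin N → Fin N → Matrix Unit Unit R) = 1 := by
        refine Matrix.ext fun i j => ?_
        by_cases h : i = j <;> simp [defMat, Matrix.one_apply, h]
      rw [this]
      exact isGlPair_one
    · intro i j; ext; simp
    · intro i j; ext; simp
    · refine ⟨Matrix.entryLinearMap k k () (), fun w => ⟨by simp, fun hw => ?_⟩⟩
      obtain rfl := List.length_eq_zero_iff.1 hw
      simp [wordProd]
  | succ d ih =>
    obtain ⟨I, _, _, X, Xb, D, h, h'⟩ := ih
    exact ⟨I × Fin N, inferInstance, inferInstance, _, _, _, h.extend hε, h'.extendRep⟩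

end Deformation

section OrderedEval

variable {R A : Type*} [CommRing R] [Ring A] [Algebra R A] {σ : Type*}

/-- The product `∏ x_i ^ m_i` in the order prescribed by the list `l`. -/
def orderedMonomial (l : List σ) (x : σ → A) (m : σ → ℕ) : A :=
  (l.map fun i => x i ^ m i).prod

/-- The evaluation of polynomials at a noncommuting family, with monomials ordered as in `l`. -/
def orderedEval (R : Type*) [CommRing R] [Algebra R A] (l : List σ) (x : σ → A) :
    MvPolynomial σ R →ₗ[R] A :=
  (MvPolynomial.basisMonomials σ R).constr R fun m => orderedMonomial l x m

lemma orderedEval_monomial (l : List σ) (x : σ → A) (m : σ →₀ ℕ) (c : R) :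
    orderedEval R l x (MvPolynomial.monomial m c) = c • orderedMonomial l x m := by
  have : MvPolynomial.monomial m c = c • MvPolynomial.basisMonomials σ R m := by
    rw [MvPolynomial.coe_basisMonomials, MvPolynomial.smul_monomial, smul_eq_mul, mul_one]
  rw [this, map_smul, orderedEval, Module.Basis.constr_basis]

lemma orderedEval_eq_sum (l : List σ) (x : σ → A) (p : MvPolynomial σ R) :
    orderedEval R l x p = ∑ m ∈ p.support, p.coeff m • orderedMonomial l x m := by
  conv_lhs => rw [p.as_sum]
  simp only [map_sum, orderedEval_monomial]

lemma map_orderedMonomial {B : Type*} [Ring B] (f : A →+* B) (l : List σ) (x : σ → A)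
    (m : σ → ℕ) : f (orderedMonomial l x m) = orderedMonomial l (fun i => f (x i)) m := by
  simp [orderedMonomial, map_list_prod, Function.comp_def]

lemma map_orderedEval {S B : Type*} [CommRing S] [Ring B] [Algebra S B] (φ : R →+* S)
    (f : A →+* B) (hf : ∀ (r : R) a, f (r • a) = φ r • f a) (l : List σ) (x : σ → A)
    (p : MvPolynomial σ R) :
    f (orderedEval R l x p) = orderedEval S l (fun i => f (x i)) (MvPolynomial.map φ p) := by
  induction p using MvPolynomial.induction_on' with
  | monomial m c =>
    rw [orderedEval_monomial, hf, MvPolynomial.map_monomial, orderedEval_monomial,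
      map_orderedMonomial]
  | add p p' h h' => simp only [map_add, h, h']

end OrderedEval

section OrderedSpan

variable {F A : Type*} [Field F] [Ring A] [Algebra F A] {σ : Type*}

lemma orderedSpan_le_span [DecidableEq σ] (x : σ → A) {l : List σ} (hl : l.Nodup) :
    orderedSpan F x l ≤ Submodule.span F (Set.range (orderedMonomial l x)) := by
  induction l with
  | nil =>
    rw [orderedSpan_nil, Submodule.one_eq_span]
    exact Submodule.span_mono (Set.singleton_subset_iff.2 ⟨0, rfl⟩)
  | cons i l ih =>
    obtain ⟨hi, hl⟩ := List.nodup_cons.1 hl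
    rw [orderedSpan_cons, Algebra.adjoin_singleton_eq_range_aeval]
    refine (mul_le_mul' (?_ : _ ≤ Submodule.span F (Set.range fun j : ℕ => x i ^ j))
      (ih hl)).trans ?_
    · rintro _ ⟨p, rfl⟩
      change Polynomial.aeval (x i) p ∈ _
      rw [Polynomial.aeval_eq_sum_range]
      exact sum_mem fun j _ => Submodule.smul_mem _ _ (Submodule.subset_span ⟨j, rfl⟩)
    · rw [Submodule.span_mul_span, Submodule.span_le]
      rintro _ ⟨_, ⟨j, rfl⟩, _, ⟨m, rfl⟩, rfl⟩
      refine Submodule.subset_span ⟨Function.update m i j, ?_⟩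
      simp only [orderedMonomial, List.map_cons, Function.update_self, List.prod_cons]
      congr 2
      refine List.map_congr_left fun i' hi' => ?_
      rw [Function.update_of_ne (ne_of_mem_of_not_mem hi' hi)]

lemma orderedSpan_le_range_orderedEval [Fintype σ] [DecidableEq σ] (x : σ → A) {l : List σ}
    (hl : l.Nodup) : orderedSpan F x l ≤ LinearMap.range (orderedEval F l x) := by
  refine (orderedSpan_le_span x hl).trans (Submodule.span_le.2 ?_)
  rintro _ ⟨m, rfl⟩
  exact ⟨MvPolynomial.monomial (Finsupp.equivFunOnFinite.symm m) 1, by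
    rw [orderedEval_monomial, one_smul, Finsupp.coe_equivFunOnFinite_symm]⟩

end OrderedSpan

section Scaling

variable {R : Type*} [CommRing R] [IsDomain R] [IsDiscreteValuationRing R] {F : Type*} [Field F]
  [Algebra R F] [IsFractionRing R F] {σ : Type*}

lemma exists_scaled_ne_zero {p : MvPolynomial σ F} (hp : p ≠ 0) :
    ∃ (c : F) (p' : MvPolynomial σ R), MvPolynomial.map (algebraMap R F) p' = c • p ∧
      MvPolynomial.map (IsLocalRing.residue R) p' ≠ 0 := by
  classical
  obtain ⟨b, hb⟩ := IsLocalization.exist_integer_multiples_of_finset (nonZeroDivisors R)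
    (p.support.image p.coeff)
  have hb' (m) : ∃ r, algebraMap R F r = (b : R) • p.coeff m := by
    by_cases hm : m ∈ p.support
    · exact hb _ (Finset.mem_image_of_mem _ hm)
    · exact ⟨0, by simp [MvPolynomial.notMem_support_iff.1 hm]⟩
  choose r hr using hb'
  set p₁ : MvPolynomial σ R := ∑ m ∈ p.support, MvPolynomial.monomial m (r m) with hp₁
  have h₁ : MvPolynomial.map (algebraMap R F) p₁ = algebraMap R F b • p := by
    conv_rhs => rw [p.as_sum]
    simp only [hp₁, map_sum, MvPolynomial.map_monomial, hr, Finset.smul_sum,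
      MvPolynomial.smul_monomial, Algebra.smul_def (R := R), smul_eq_mul]
  have hb0 : algebraMap R F b ≠ 0 := IsFractionRing.to_map_ne_zero_of_mem_nonZeroDivisors b.2
  have h₁0 : p₁ ≠ 0 := by
    rintro h
    rw [h, map_zero] at h₁
    exact smul_ne_zero hb0 hp h₁.symm
  obtain ⟨ϖ, hϖ⟩ := IsDiscreteValuationRing.exists_irreducible R
  obtain ⟨e, p₂, hp₂, he⟩ := WfDvdMonoid.max_power_factor' h₁0 (x := MvPolynomial.C ϖ)
    fun h => hϖ.not_isUnit (by simpa using h.map MvPolynomial.constantCoeff)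
  have hϖ0 : algebraMap R F ϖ ≠ 0 := by simpa using hϖ.ne_zero
  refine ⟨(algebraMap R F ϖ ^ e)⁻¹ * algebraMap R F b, p₂, ?_, fun h => hp₂ ?_⟩
  · rw [mul_smul, ← h₁, he, map_mul, map_pow, MvPolynomial.map_C, ← MvPolynomial.C_pow,
      ← MvPolynomial.smul_eq_C_mul, smul_smul, inv_mul_cancel₀ (pow_ne_zero _ hϖ0), one_smul]
  · refine (MvPolynomial.C_dvd_iff_map_hom_eq_zero (IsLocalRing.residue R) ϖ (fun r' => ?_) p₂).2 h
    rw [IsLocalRing.residue_eq_zero_iff, hϖ.maximalIdeal_eq, Ideal.mem_span_singleton]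

end Scaling

section Detection

variable {k : Type} [Field k] {I J : Type} [Fintype I] [DecidableEq I] {σ : Type*}

lemma orderedMonomial_eq_wordProd (D : Matrix J J k →ₗ[k] Matrix I I k) (κ : σ → k)
    (Z : σ → Matrix J J k) (l : List σ) (m : σ → ℕ) :
    orderedMonomial l (fun i => κ i • (1 : Matrix I I k) + D (Z i)) m
      = wordProd D (l.flatMap fun i => List.replicate (m i) (κ i, Z i)) := by
  induction l with
  | nil => simp [orderedMonomial, wordProd]
  | cons i l ih =>
    simp only [orderedMonomial, wordProd, List.map_cons, List.prod_cons, List.flatMap_cons,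
      List.map_append, List.prod_append, List.map_replicate, List.prod_replicate] at ih ⊢
    rw [ih]

variable [DecidableEq J] [Fintype σ] [DecidableEq σ]

lemma MvPolynomial.eq_zero_of_orderedEval_eq_zero [CharZero k] {l : List σ} (hl : l.Nodup)
    (hl' : ∀ i, i ∈ l) (κ : σ → k) (Z : σ → Matrix J J k)
    (hZ : ∀ v : σ → k, ∃ f : Matrix J J k →ₗ[k] k, f 1 = 0 ∧ ∀ i, f (Z i) = v i)
    {p : MvPolynomial σ k} {D : Matrix J J k →ₗ[k] Matrix I I k} (hD : Detects D p.totalDegree)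
    (hp : orderedEval k l (fun i => κ i • (1 : Matrix I I k) + D (Z i)) p = 0) : p = 0 := by
  by_contra hp0
  set d := p.totalDegree with hd
  have hu : l.toFinset = Finset.univ := Finset.eq_univ_iff_forall.2 fun i => by simpa using hl' i
  suffices MvPolynomial.homogeneousComponent d p = 0 by
    obtain ⟨m, hm, hmd⟩ := Finset.exists_mem_eq_sup p.support
      (Finset.nonempty_iff_ne_empty.2 (by simpa using hp0)) fun m => m.degree
    have h := MvPolynomial.coeff_homogeneousComponent d p m
    have : m.degree = d := by
      rw [← hmd]; rfl
    rw [‹MvPolynomial.homogeneousComponent d p = 0›, if_pos this, MvPolynomial.coeff_zero] at h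
    exact MvPolynomial.mem_support_iff.1 hm h.symm
  refine MvPolynomial.funext fun v => ?_
  obtain ⟨f, hf, hfZ⟩ := hZ v
  obtain ⟨Φ, hΦ⟩ := hD f hf
  have hlen (m : σ →₀ ℕ) :
      (l.flatMap fun i => List.replicate (m i) (κ i, Z i)).length = m.degree := by
    rw [List.length_flatMap, Finsupp.degree_eq_sum, ← hu, List.sum_toFinset _ hl]
    simp
  have hval (m : σ →₀ ℕ) : ((l.flatMap fun i => List.replicate (m i) (κ i, Z i)).map
      fun c => f c.2).prod = ∏ i, v i ^ m i := by
    rw [← hu, List.prod_toFinset _ hl, List.map_flatMap, List.flatMap, List.prod_flatten]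
    simp [hfZ, Function.comp_def]
  have h0 := congr_arg Φ hp
  rw [orderedEval_eq_sum, map_sum, map_zero] at h0
  have hterm (m) (hm : m ∈ p.support) :
      Φ (p.coeff m • orderedMonomial l (fun i => κ i • (1 : Matrix I I k) + D (Z i)) m)
        = if m.degree = d then d.factorial * (p.coeff m * ∏ i, v i ^ m i) else 0 := by
    rw [map_smul, orderedMonomial_eq_wordProd, smul_eq_mul]
    split_ifs with h
    · rw [(hΦ _).2 ((hlen m).trans h), hval]
      ring
    · rw [(hΦ _).1, mul_zero]
      rw [hlen]
      exact lt_of_le_of_ne (MvPolynomial.le_totalDegree hm) h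
  rw [Finset.sum_congr rfl hterm, ← Finset.sum_filter, ← Finset.mul_sum] at h0
  rw [map_zero, MvPolynomial.homogeneousComponent_apply, map_sum]
  simp only [MvPolynomial.eval_monomial, Finsupp.prod_fintype, pow_zero, implies_true]
  exact (mul_eq_zero.1 h0).resolve_left (Nat.cast_ne_zero.2 d.factorial_ne_zero)

end Detection

section Injectivity

variable {R : Type} [CommRing R] [IsDomain R] [IsDiscreteValuationRing R]
  [CharZero (IsLocalRing.ResidueField R)] {F : Type} [Field F] [Algebra R F] [IsFractionRing R F]
  {J : Type} [DecidableEq J] {σ : Type*} [Fintype σ] [DecidableEq σ]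

/-- A polynomial vanishes if its values do at families of matrices with entries in a discrete
valuation ring whose reductions are `κ + D Z` with `D` detecting polynomials of large degree. -/
theorem MvPolynomial.eq_zero_of_reduction {l : List σ} (hl : l.Nodup) (hl' : ∀ i, i ∈ l)
    (κ : σ → IsLocalRing.ResidueField R) (Z : σ → Matrix J J (IsLocalRing.ResidueField R))
    (hZ : ∀ v : σ → IsLocalRing.ResidueField R, ∃ f : Matrix J J (IsLocalRing.ResidueField R)
      →ₗ[IsLocalRing.ResidueField R] IsLocalRing.ResidueField R, f 1 = 0 ∧ ∀ i, f (Z i) = v i)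
    {p : MvPolynomial σ F}
    (hp : ∀ d, ∃ (I : Type) (_ : Fintype I) (_ : DecidableEq I) (Y : σ → Matrix I I R)
      (D : Matrix J J (IsLocalRing.ResidueField R) →ₗ[IsLocalRing.ResidueField R]
        Matrix I I (IsLocalRing.ResidueField R)), Detects D d ∧
        (∀ i, (Y i).map (IsLocalRing.residue R) = κ i • 1 + D (Z i)) ∧
        orderedEval F l (fun i => (Y i).map (algebraMap R F)) p = 0) : p = 0 := by
  by_contra hp0
  obtain ⟨c, p', hc, hp'⟩ := exists_scaled_ne_zero (R := R) hp0
  obtain ⟨I, _, _, Y, D, hD, hY, h⟩ :=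
    hp (MvPolynomial.map (IsLocalRing.residue R) p').totalDegree
  have hYp : orderedEval R l Y p' = 0 := by
    have hinj : Function.Injective ((algebraMap R F).mapMatrix (m := I)) :=
      Matrix.map_injective (IsFractionRing.injective R F)
    refine hinj ?_
    rw [map_orderedEval (algebraMap R F) _ (fun r a => by ext; simp), hc, map_smul, map_zero]
    exact (congr_arg (c • ·) h).trans (smul_zero c)
  refine hp' (MvPolynomial.eq_zero_of_orderedEval_eq_zero hl hl' κ Z hZ hD ?_)
  have := map_orderedEval (IsLocalRing.residue R) (IsLocalRing.residue R).mapMatrix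
    (fun r a => by ext; simp) l Y p'
  rw [hYp, map_zero] at this
  simpa only [RingHom.mapMatrix_apply, hY] using this.symm

end Injectivity

section SpDeformation

variable {R : Type} [CommRing R] {F : Type} [Field F] [Algebra R F] {k : Type} [Field k] {n : ℕ}
  {I : Type} [Fintype I] [DecidableEq I]

/-- The index pairs of the generators `s_ij` in the ordered monomials spanning `𝒮` up to powers of
the elements `s_{ii'}`. -/
def spPairs (n : ℕ) : List (Fin (2 * n) × Fin (2 * n)) :=
  offPairs n ++ diagPairs (List.finRange n) ++ upPairs n

lemma nodup_spPairs (n : ℕ) : (spPairs n).Nodup := by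
  have hdiag : (diagPairs (List.finRange n)).Nodup := by
    refine List.nodup_flatMap.2 ⟨fun k _ => by simp, (List.nodup_finRange n).imp fun {k l} h => ?_⟩
    simp [Function.onFun, Ne.symm h]
  have hup : (upPairs n).Nodup :=
    (List.nodup_finRange n).map fun k l h => by simpa using h
  refine List.Nodup.append (List.Nodup.append (Finset.nodup_toList _) hdiag ?_) hup ?_
  · rintro ⟨i, j⟩ h h'
    simp [offPairs, diagPairs] at h h'
    grind
  · rintro ⟨i, j⟩ h h'
    simp [offPairs, diagPairs, upPairs] at h h'
    obtain ⟨k, rfl, rfl⟩ := h'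
    rcases h with h | ⟨l, ⟨h, hl⟩ | ⟨h, hl⟩⟩
    · simp [fe, fo] at h; omega
    · simp at h
    · simp at hl

/-- The matrices `X` for which `T G T̄ᵗ = G + (q - 1) X` in a deformation of the trivial
representation. -/
def spX (qR : R) (X Xb : Fin (2 * n) → Fin (2 * n) → Matrix I I R) (i j : Fin (2 * n)) :
    Matrix I I R :=
  gCoef qR i • Xb j (pairIdx i) + gCoef qR (pairIdx j) • X i (pairIdx j)
    + (qR - 1) • ∑ a, gCoef qR a • (X i a * Xb j (pairIdx a))

/-- The first order term of `T G T̄ᵗ` in the vector representation. -/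
def spLim (k : Type) [Field k] (i j : Fin (2 * n)) : Matrix (Fin (2 * n)) (Fin (2 * n)) k :=
  gCoef (1 : k) i • limTb k j (pairIdx i) + gCoef (1 : k) (pairIdx j) • limT k i (pairIdx j)

lemma map_gCoef {S : Type*} [CommRing S] (f : R →+* S) (q : R) (i : Fin (2 * n)) :
    f (gCoef q i) = gCoef (f q) i := by
  simp [gCoef, apply_ite f]

lemma spMat_defMat (qR : R) (X Xb : Fin (2 * n) → Fin (2 * n) → Matrix I I R)
    (i j : Fin (2 * n)) :
    spMat (algebraMap R F qR) (defMat F qR X) (defMat F qR Xb) i j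
      = ((if j = pairIdx i then gCoef qR i • 1 else 0) + (qR - 1) • spX qR X Xb i j).map
        (algebraMap R F) := by
  have key : ∑ a, gCoef qR a • (((if i = a then 1 else 0) + (qR - 1) • X i a)
        * ((if j = pairIdx a then 1 else 0) + (qR - 1) • Xb j (pairIdx a)))
      = (if j = pairIdx i then gCoef qR i • 1 else 0) + (qR - 1) • spX qR X Xb i j := by
    simp only [add_mul, mul_add, smul_add, Finset.sum_add_distrib, ite_mul, mul_ite, one_mul,
      mul_one, zero_mul, mul_zero, smul_ite, smul_zero, Finset.sum_ite_eq, Finset.mem_univ,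
      if_true, eq_pairIdx_comm (i := j), spX, Finset.smul_sum, Finset.sum_ite_eq', smul_mul_assoc,
      mul_smul_comm]
    simp only [smul_comm (gCoef qR _) (qR - 1)]
    by_cases h : i = pairIdx j
    · subst h
      abel
    · simp only [if_neg h]
      abel
  rw [spMat_apply, ← key, ← RingHom.mapMatrix_apply, map_sum]
  refine Finset.sum_congr rfl fun a _ => ?_
  have hsmul (c : R) (M : Matrix I I R) : (algebraMap R F).mapMatrix (c • M)
      = algebraMap R F c • (algebraMap R F).mapMatrix M := by ext; simp
  rw [hsmul, map_mul, map_gCoef]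
  rfl

lemma IsDefRep.map_spX {ε : R →+* k} {qR : Rˣ} (hε : ε qR = 1)
    {X Xb : Fin (2 * n) → Fin (2 * n) → Matrix I I R}
    {D : Matrix (Fin (2 * n)) (Fin (2 * n)) k →ₗ[k] Matrix I I k} (h : IsDefRep F ε qR X Xb D)
    (i j : Fin (2 * n)) : (spX (qR : R) X Xb i j).map ε = D (spLim k i j) := by
  have hsmul (c : R) (M : Matrix I I R) : ε.mapMatrix (c • M) = ε c • ε.mapMatrix M := by
    ext; simp
  rw [← RingHom.mapMatrix_apply, spX, map_add, map_add, hsmul, hsmul, hsmul, map_gCoef, map_gCoef,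
    map_sub, map_one, hε, sub_self, zero_smul, add_zero, RingHom.mapMatrix_apply,
    RingHom.mapMatrix_apply, h.lim, h.limb, spLim, map_add, map_smul, map_smul]

lemma exists_functional_spLim [CharZero k] (v : Fin (2 * n) × Fin (2 * n) → k) :
    ∃ f : Matrix (Fin (2 * n)) (Fin (2 * n)) k →ₗ[k] k,
      f 1 = 0 ∧ ∀ p ∈ spPairs n, f (spLim k p.1 p.2) = v p := by
  have h2 : (2 : k) ≠ 0 := two_ne_zero
  let w (i j : Fin (2 * n)) : k :=
    if i.val / 2 < j.val / 2 then 0 else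
      if i = pairIdx j ∧ j < i then v (j, i) else v (i, j)
  let C : Matrix (Fin (2 * n)) (Fin (2 * n)) k :=
    Matrix.of fun b a => w (pairIdx a) b * gCoef 1 (pairIdx a) / 2
  let f : Matrix (Fin (2 * n)) (Fin (2 * n)) k →ₗ[k] k :=
    Matrix.traceLinearMap _ k k ∘ₗ LinearMap.mulLeft k C
  have hf (a b : Fin (2 * n)) (c : k) :
      f (Matrix.single a b c) = w (pairIdx a) b * gCoef 1 (pairIdx a) / 2 * c := by
    simp [f, C, Matrix.trace_mul_single]
  have he (l : Fin n) : (fe n l).val / 2 = l := by simp [fe]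
  have ho (l : Fin n) : (fo n l).val / 2 = l := by simp only [fo]; omega
  have hw (l : Fin n) : w (fo n l) (fe n l) = w (fe n l) (fo n l) := by
    simp [w, he, ho]
  refine ⟨f, ?_, fun p hp => ?_⟩
  · simp [f, C, Matrix.trace, sum_fe_fo, hw, neg_div]
  · have hp' : (p.2.val / 2 < p.1.val / 2) ∨ (∃ l, p = (fo n l, fo n l)) ∨
        (∃ l, p = (fe n l, fe n l)) ∨ ∃ l, p = (fe n l, fo n l) := by
      simp [spPairs, offPairs, diagPairs, upPairs] at hp
      grind
    rcases hp' with h | ⟨l, rfl⟩ | ⟨l, rfl⟩ | ⟨l, rfl⟩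
    · obtain ⟨i, j⟩ := p
      have h1 : j < pairIdx i := by
        simp only [pairIdx, Fin.lt_def] at *; split_ifs <;> omega
      have h3 : pairIdx j < i := by
        simp only [pairIdx, Fin.lt_def] at *; split_ifs <;> omega
      have h4 : ¬ i = pairIdx j := h3.ne'
      have h5 : w i j = v (i, j) := by simp [w, h4, not_lt.2 (le_of_lt h)]
      have h6 : w j i = 0 := by simpa [w] using fun h' => absurd h (by simpa using h')
      have hg : gCoef (1 : k) i * gCoef 1 i = 1 := by simp only [gCoef]; split_ifs <;> simp
      simp only [spLim, limTb, limT, h1, h1.ne, h3, h4, if_true, if_false, map_add, map_smul, hf,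
        pairIdx_pairIdx, h5, h6, smul_eq_mul]
      field_simp
      linear_combination v (i, j) * hg
    · simp [spLim, limTb, limT, hf, w]
    · simp [spLim, limTb, limT, hf, w]
    · simp [spLim, limTb, limT, hf, hw]
      simp only [w, he, ho, lt_irrefl, if_false, pairIdx_fo]
      simp
      ring

end SpDeformation

section SpInjectivity

variable {F : Type} [Field F]

lemma orderedSpan_mono {B : Type*} [Ring B] [Algebra F B] {ι : Type*} {g g' : ι → B} {l : List ι}
    (h : ∀ i ∈ l, g i ∈ Algebra.adjoin F {g' i}) : orderedSpan F g l ≤ orderedSpan F g' l := by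
  induction l with
  | nil => rw [orderedSpan_nil, orderedSpan_nil]
  | cons i l ih =>
    rw [orderedSpan_cons, orderedSpan_cons]
    refine mul_le_mul' (Algebra.adjoin_le ?_) (ih fun j hj => h j (.tail _ hj))
    exact Set.singleton_subset_iff.2 (h i (.head _))

variable {q : F} {n : ℕ} {R : Type} [CommRing R] [IsDomain R] [IsDiscreteValuationRing R]
  [CharZero (IsLocalRing.ResidueField R)] [Algebra R F] [IsFractionRing R F]

/-- The homomorphism from `𝒮` to `U_q(gl_2n)` is injective. -/
theorem IsSpPair.lift_gl_injective (qR : Rˣ) (hqR : algebraMap R F qR = q)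
    (hq1 : (qR : R) - 1 ∈ IsLocalRing.maximalIdeal R) (hq : q ≠ 1)
    {u : Fin n → UqGl F q (2 * n)}
    (h : IsSpPair q (spMat q (Matrix.of (tE F q (2 * n))) (Matrix.of (tbE F q (2 * n)))) u) :
    Function.Injective h.lift := by
  have hq0 : q ≠ 0 := hqR ▸ (qR.isUnit.map (algebraMap R F)).ne_zero
  have hε : IsLocalRing.residue R qR = 1 := by
    rw [← sub_eq_zero, ← map_one (IsLocalRing.residue R), ← map_sub]
    exact (IsLocalRing.residue_eq_zero_iff _).2 hq1
  have : IsScalarTower R F (AlgSp F q n) := inferInstance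
  refine (injective_iff_map_eq_zero _).2 fun f hf => ?_
  have hgen := isSpPair_gen q n
  obtain ⟨M, hM⟩ := hgen.exists_mul_pow_mem hq0 qR hqR hq1 (by
    rw [← adjoin_spGen q n]
    congr 2
    ext x
    simp [entry, eq_comm]) f
  set c : Fin (2 * n) × Fin (2 * n) → F := fun p => if p.2 = pairIdx p.1 then gCoef q p.1 else 0
  set x : {p // p ∈ spPairs n} → AlgSp F q n := fun p =>
    (q - 1)⁻¹ • (sSpP F q n p.1.1 p.1.2 - c p.1 • 1)
  have hM' : f * zProd (Matrix.of (sSpP F q n)) ^ M ∈ orderedSpan F x (spPairs n).attach := by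
    have : orderedSpan F (entry (Matrix.of (sSpP F q n))) (spPairs n)
        = orderedSpan F (fun p : {p // p ∈ spPairs n} => sSpP F q n p.1.1 p.1.2)
          (spPairs n).attach := by
      conv_lhs => rw [← List.attach_map_subtype_val (spPairs n)]
      simp only [orderedSpan, List.map_map]
      rfl
    rw [← spPairs, this] at hM
    refine orderedSpan_mono (fun p _ => ?_) hM
    have hx : sSpP F q n p.1.1 p.1.2 = (q - 1) • x p + c p.1 • 1 := by
      rw [smul_inv_smul₀ (sub_ne_zero.2 hq), sub_add_cancel]
    rw [hx]
    exact add_mem (Subalgebra.smul_mem _ (Algebra.self_mem_adjoin_singleton F (x p)) _)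
      (Subalgebra.smul_mem _ (one_mem _) _)
  obtain ⟨p, hp⟩ := orderedSpan_le_range_orderedEval x (List.nodup_attach.2 (nodup_spPairs n)) hM'
  have hp0 : p = 0 := by
    refine MvPolynomial.eq_zero_of_reduction (R := R) (List.nodup_attach.2 (nodup_spPairs n))
      (List.mem_attach _) 0 (fun p => spLim _ p.1.1 p.1.2) (fun v => ?_) (fun d => ?_)
    · obtain ⟨g, hg1, hg⟩ := exists_functional_spLim
        (fun p => if hp : p ∈ spPairs n then v ⟨p, hp⟩ else 0)
      exact ⟨g, hg1, fun p => by rw [hg p.1 p.2, dif_pos p.2]⟩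
    · obtain ⟨I, _, _, X, Xb, D, hrep, hD⟩ := exists_isDefRep (N := 2 * n) (F := F) hε d
      refine ⟨I, _, _, fun p => spX (qR : R) X Xb p.1.1 p.1.2, D, hD,
        fun p => by simpa using hrep.map_spX hε _ _, ?_⟩
      have hpair : IsGlPair q (defMat F (qR : R) X) (defMat F (qR : R) Xb) := hqR ▸ hrep.pair
      let ψ := hpair.lift.comp h.lift
      have hψ : ψ (orderedEval F (spPairs n).attach x p) = 0 := by
        rw [hp, map_mul, AlgHom.comp_apply, hf, map_zero, zero_mul]
      have := map_orderedEval (RingHom.id F) ψ.toRingHom (map_smul ψ)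
        (spPairs n).attach x p
      rw [MvPolynomial.map_id] at this
      refine Eq.trans ?_ (this.symm.trans hψ)
      congr 2
      ext1 p
      have hS : ψ (sSpP F q n p.1.1 p.1.2)
          = spMat q (defMat F (qR : R) X) (defMat F (qR : R) Xb) p.1.1 p.1.2 := by
        simp only [ψ, AlgHom.comp_apply, IsSpPair.lift_sSpP, spMat_apply, map_sum, map_smul,
          map_mul, Matrix.of_apply, IsGlPair.lift_tE, IsGlPair.lift_tbE]
      have hc : c p.1 = algebraMap R F
          (if p.1.2 = pairIdx p.1.1 then gCoef (qR : R) p.1.1 else 0) := by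
        rw [apply_ite (algebraMap R F), map_zero, map_gCoef, hqR]
      have hq1' : q - 1 = algebraMap R F ((qR : R) - 1) := by rw [map_sub, hqR, map_one]
      change _ = ψ (x p)
      have hS' := spMat_defMat (F := F) (qR : R) X Xb p.1.1 p.1.2
      rw [hqR] at hS'
      rw [map_smul, map_sub, map_smul, map_one, hS, hS', eq_inv_smul_iff₀ (sub_ne_zero.2 hq), hc,
        hq1']
      ext a b
      split_ifs <;>
        simp [Matrix.one_apply, apply_ite (algebraMap R F), -algebraMap_smul]
  rw [hp0, map_zero] at hp
  exact (hgen.isUnit_zProd.pow M).mul_left_eq_zero.1 hp.symm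

end SpInjectivity

section LocalRing

open Polynomial

lemma qq_ne_one : qq ≠ 1 := by
  intro h
  have : algebraMap ℂ[X] FF X = algebraMap ℂ[X] FF 1 := by
    rw [map_one, RatFunc.algebraMap_X]; exact h
  simpa using congrArg natDegree (RatFunc.algebraMap_injective ℂ this)

lemma exists_local_subring : ∃ (R : Type) (_ : CommRing R) (_ : IsDomain R)
    (_ : IsDiscreteValuationRing R) (_ : CharZero (IsLocalRing.ResidueField R)) (_ : Algebra R FF)
    (_ : IsFractionRing R FF) (qR : Rˣ), algebraMap R FF qR = qq ∧
      (qR : R) - 1 ∈ IsLocalRing.maximalIdeal R := by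
  let P : Ideal ℂ[X] := Ideal.span {X - C 1}
  have hP : P.IsPrime := (Ideal.span_singleton_prime (X_sub_C_ne_zero 1)).2 (prime_X_sub_C 1)
  have hP0 : P ≠ ⊥ := by simpa [P, Ideal.span_singleton_eq_bot] using X_sub_C_ne_zero (1 : ℂ)
  let R := Localization.subalgebra.ofField FF P.primeCompl P.primeCompl_le_nonZeroDivisors
  have : IsLocalization.AtPrime R P :=
    Localization.subalgebra.isLocalization_ofField FF _ P.primeCompl_le_nonZeroDivisors
  have : IsFractionRing R FF :=
    Localization.subalgebra.isFractionRing_ofField FF _ P.primeCompl_le_nonZeroDivisors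
  have : IsDiscreteValuationRing R :=
    IsLocalization.AtPrime.isDiscreteValuationRing_of_dedekind_domain ℂ[X] hP0 R
  have : CharZero (IsLocalRing.ResidueField R) :=
    charZero_of_injective_ringHom
      (((IsLocalRing.residue R).comp (algebraMap ℂ[X] R)).comp C).injective
  have hX : (X : ℂ[X]) ∈ P.primeCompl := fun h => by
    have := dvd_iff_isRoot.1 (Ideal.mem_span_singleton.1 h)
    simp at this
  refine ⟨R, _, inferInstance, inferInstance, inferInstance, inferInstance, inferInstance,
    (IsLocalization.map_units R ⟨X, hX⟩).unit, ?_, ?_⟩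
  · rw [IsUnit.unit_spec, ← IsScalarTower.algebraMap_apply ℂ[X] R FF]
    exact RatFunc.algebraMap_X
  · rw [IsUnit.unit_spec]
    have := (IsLocalization.AtPrime.to_map_mem_maximal_iff R P (X - C 1)).2
      (Ideal.mem_span_singleton_self _)
    simpa using this

end LocalRing

/-- The abstract symplectic algebra `𝒮` is isomorphic to
`U^tw_q(sp_2n)`, via `s_ij ↦ (T G T̄ᵗ)_ij` and `s_{ii'}^{-1} ↦` the inverse of the
corresponding entry. -/
theorem stmt6 (n : ℕ) (inv : Fin n → UqGl FF qq (2 * n))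
    (hinv : ∀ k : Fin n,
      sSp FF qq n (fe n k) (fo n k) * inv k = 1 ∧
        inv k * sSp FF qq n (fe n k) (fo n k) = 1) :
    ∃ φ : AlgSp FF qq n ≃ₐ[FF]
        (Algebra.adjoin FF ({x | ∃ i j, x = sSp FF qq n i j} ∪ Set.range inv)),
      (∀ i j : Fin (2 * n),
          (φ (sSpP FF qq n i j) : UqGl FF qq (2 * n)) = sSp FF qq n i j) ∧
        ∀ k : Fin n, (φ (sInvP FF qq n k) : UqGl FF qq (2 * n)) = inv k := by
  obtain ⟨R, _, _, _, _, _, _, qR, hqR, hq1⟩ := exists_local_subring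
  have hq : qq ≠ 0 := RatFunc.X_ne_zero
  have hS : IsSpPair qq _ inv := (isGlPair_gen qq (2 * n)).isSpPair hq fun k => by
    rw [spMat_gen]
    exact hinv k
  have hinj : Function.Injective hS.lift := hS.lift_gl_injective qR hqR hq1 qq_ne_one
  have hrange : hS.lift.range
      = Algebra.adjoin FF ({x | ∃ i j, x = sSp FF qq n i j} ∪ Set.range inv) := by
    rw [← Algebra.map_top, ← adjoin_spGen qq n, AlgHom.map_adjoin, Set.image_union,
      ← Set.range_comp]
    congr 2
    · ext x
      constructor
      · rintro ⟨_, ⟨i, j, rfl⟩, rfl⟩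
        exact ⟨i, j, by rw [hS.lift_sSpP, spMat_gen]⟩
      · rintro ⟨i, j, rfl⟩
        exact ⟨_, ⟨i, j, rfl⟩, by rw [hS.lift_sSpP, spMat_gen]⟩
    · exact congrArg _ (funext hS.lift_sInvP)
  refine ⟨(AlgEquiv.ofInjective hS.lift hinj).trans (Subalgebra.equivOfEq _ _ hrange),
    fun i j => ?_, fun k => ?_⟩
  · exact (hS.lift_sSpP i j).trans (spMat_gen i j)
  · exact hS.lift_sInvP k
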